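/- arXiv:2009.11936 — 11 statements merged into one kernel-verified Lean document; each statement's English description precedes it below -/
import Mathlib

section
/- Let q > 0 and let μ ∈ (0, π/2) satisfy μ·tan(μ) = q. Then every continuously differentiable function w : [0,1] → ℝ satisfies μ²·∫₀¹ w(x)² dx ≤ q·w(1)² + ∫₀¹ w′(x)² dx. -/
open Real Set

theorem hasDerivAt_mul_tan_mul (μ x : ℝ) (hx : Real.cos (μ * x) ≠ 0) :
    HasDerivAt (fun y => μ * Real.tan (μ * y)) (μ ^ 2 + (μ * Real.tan (μ * x)) ^ 2) x := by
  have h := ((Real.hasDerivAt_tan hx).comp x ((hasDerivAt_id x).const_mul μ)).const_mul μ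
  refine h.congr_deriv ?_
  rw [one_div, ← Real.inv_one_add_tan_sq hx, inv_inv]
  ring

/-- If `p' = c + p ^ 2` (a Riccati equation), completing the square bounds the integral of `c * w ^ 2`
by that of `w' ^ 2` up to the boundary terms of `p * w ^ 2`. -/
theorem integral_mul_sq_le_of_riccati {a b c : ℝ} (hab : a ≤ b) {p w w' : ℝ → ℝ}
    (hp : ∀ x ∈ Icc a b, HasDerivAt p (c + p x ^ 2) x)
    (hw : ∀ x ∈ Icc a b, HasDerivWithinAt w (w' x) (Icc a b) x)
    (hw' : ContinuousOn w' (Icc a b)) :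
    c * ∫ x in a..b, w x ^ 2 ≤
      p b * w b ^ 2 - p a * w a ^ 2 + ∫ x in a..b, w' x ^ 2 := by
  have hwc : ContinuousOn w (Icc a b) := fun x hx => (hw x hx).continuousWithinAt
  have hpc : ContinuousOn p (Icc a b) := fun x hx => (hp x hx).continuousAt.continuousWithinAt
  have hw2 : IntervalIntegrable (fun x => c * w x ^ 2) MeasureTheory.volume a b :=
    ContinuousOn.intervalIntegrable_of_Icc hab (by fun_prop)
  have hw'2 : IntervalIntegrable (fun x => w' x ^ 2) MeasureTheory.volume a b :=
    ContinuousOn.intervalIntegrable_of_Icc hab (by fun_prop)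
  have hderiv : IntervalIntegrable (fun x => (c + p x ^ 2) * w x ^ 2 + p x * (2 * w x * w' x))
      MeasureTheory.volume a b :=
    ContinuousOn.intervalIntegrable_of_Icc hab (by fun_prop)
  have hFTC : ∫ x in a..b, ((c + p x ^ 2) * w x ^ 2 + p x * (2 * w x * w' x)) =
      p b * w b ^ 2 - p a * w a ^ 2 := by
    refine intervalIntegral.integral_eq_sub_of_hasDerivAt_of_le
      (f := fun x => p x * w x ^ 2) hab (by fun_prop) (fun x hx => ?_) hderiv
    have hwx := (hw x (Ioo_subset_Icc_self hx)).hasDerivAt (Icc_mem_nhds hx.1 hx.2)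
    exact ((hp x (Ioo_subset_Icc_self hx)).mul (hwx.pow 2)).congr_deriv (by simp)
  rw [← hFTC, ← intervalIntegral.integral_add hderiv hw'2,
    ← intervalIntegral.integral_const_mul]
  refine intervalIntegral.integral_mono_on hab hw2 (hderiv.add hw'2) fun x _ => ?_
  linarith [sq_nonneg (w' x + p x * w x)]

theorem robin_rayleigh_quotient_bound (q μ : ℝ) (hq : 0 < q)
    (hμ : μ ∈ Ioo 0 (π / 2)) (hroot : μ * Real.tan μ = q)
    (w w' : ℝ → ℝ)
    (hw : ∀ x ∈ Icc (0:ℝ) 1, HasDerivWithinAt w (w' x) (Icc 0 1) x)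
    (hw' : ContinuousOn w' (Icc 0 1)) :
    μ ^ 2 * ∫ x in (0:ℝ)..1, (w x) ^ 2 ≤
      q * (w 1) ^ 2 + ∫ x in (0:ℝ)..1, (w' x) ^ 2 := by
  obtain ⟨hμ0, hμ1⟩ := hμ
  have hcos : ∀ x ∈ Icc (0:ℝ) 1, Real.cos (μ * x) ≠ 0 := fun x hx =>
    (Real.cos_pos_of_mem_Ioo ⟨by nlinarith [hx.1], by nlinarith [hx.2]⟩).ne'
  have h := integral_mul_sq_le_of_riccati zero_le_one
    (fun x hx => hasDerivAt_mul_tan_mul μ x (hcos x hx)) hw hw'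
  simpa [hroot] using h
end

section
/- Let ε > 0, q > 0, λ ∈ ℝ, and let μ ∈ (0, π/2) be the unique solution of μ·tan(μ) = q. Let u be a classical solution on [0,1]×[0,∞) of u_t(x,t) = ε u_xx(x,t) + λ u(x,t) with boundary conditions u_x(0,t) = 0 and u_x(1,t) + q u(1,t) = 0. Then ‖u[t]‖ ≤ e^{(λ−εμ²)t}·‖u[0]‖ for all t ≥ 0. -/
open Real Set

/-- Regularity of a classical solution of a 1-D parabolic PDE on `[0,1] × I`:
`u` together with its partial derivatives `ut`, `ux`, `uxx` are continuous on `[0,1] × I`,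
and `ut`, `ux`, `uxx` really are the corresponding partial derivatives of `u`. -/
structure ClassicalReg (I : Set ℝ) (u ut ux uxx : ℝ → ℝ → ℝ) : Prop where
  cont : ContinuousOn (fun p : ℝ × ℝ => u p.1 p.2) (Icc 0 1 ×ˢ I)
  cont_ut : ContinuousOn (fun p : ℝ × ℝ => ut p.1 p.2) (Icc 0 1 ×ˢ I)
  cont_ux : ContinuousOn (fun p : ℝ × ℝ => ux p.1 p.2) (Icc 0 1 ×ˢ I)
  cont_uxx : ContinuousOn (fun p : ℝ × ℝ => uxx p.1 p.2) (Icc 0 1 ×ˢ I)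
  deriv_t : ∀ x ∈ Icc (0:ℝ) 1, ∀ t ∈ I, HasDerivWithinAt (fun s => u x s) (ut x t) I t
  deriv_x : ∀ x ∈ Icc (0:ℝ) 1, ∀ t ∈ I, HasDerivWithinAt (fun s => u s t) (ux x t) (Icc 0 1) x
  deriv_xx : ∀ x ∈ Icc (0:ℝ) 1, ∀ t ∈ I, HasDerivWithinAt (fun s => ux s t) (uxx x t) (Icc 0 1) x

open MeasureTheory

/-- Riccati form of the spectral gap: `μ` is the square root of the lowest eigenvalue of minus the
second derivative with Neumann condition at `0` and Robin condition at `1`. -/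
theorem integral_mul_second_deriv_add_sq_nonpos {q μ : ℝ} (hμ : μ ∈ Ioo 0 (π / 2))
    (hroot : μ * Real.tan μ = q) {v v' v'' : ℝ → ℝ}
    (hv : ∀ x ∈ Icc (0:ℝ) 1, HasDerivWithinAt v (v' x) (Icc 0 1) x)
    (hv' : ∀ x ∈ Icc (0:ℝ) 1, HasDerivWithinAt v' (v'' x) (Icc 0 1) x)
    (hv'' : ContinuousOn v'' (Icc 0 1))
    (h0 : v' 0 = 0) (h1 : v' 1 + q * v 1 = 0) :
    ∫ x in (0:ℝ)..1, (v x * v'' x + μ ^ 2 * v x ^ 2) ≤ 0 := by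
  have hcos : ∀ x ∈ Icc (0:ℝ) 1, Real.cos (μ * x) ≠ 0 := fun x hx =>
    (Real.cos_pos_of_mem_Ioo ⟨by nlinarith [hμ.1, hμ.2, hx.1, hx.2, Real.pi_pos],
      by nlinarith [hμ.1, hμ.2, hx.1, hx.2]⟩).ne'
  have htan : ∀ x ∈ Icc (0:ℝ) 1, HasDerivAt (fun y => Real.tan (μ * y))
      ((1 + Real.tan (μ * x) ^ 2) * μ) x := by
    intro x hx
    have h := (Real.hasDerivAt_tan (hcos x hx)).comp x ((hasDerivAt_id x).const_mul μ)
    refine h.congr_deriv ?_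
    rw [one_div, ← Real.inv_one_add_tan_sq (hcos x hx), inv_inv]
    simp
  have hderiv : ∀ x ∈ Icc (0:ℝ) 1,
      HasDerivWithinAt (fun y => v y * v' y + μ * Real.tan (μ * y) * v y ^ 2)
        (v x * v'' x + μ ^ 2 * v x ^ 2 + (v' x + μ * Real.tan (μ * x) * v x) ^ 2)
        (Icc 0 1) x := by
    intro x hx
    have h := ((hv x hx).mul (hv' x hx)).add
      ((((htan x hx).hasDerivWithinAt (s := Icc 0 1)).const_mul μ).mul ((hv x hx).pow 2))
    refine h.congr_deriv ?_
    simp only [Pi.pow_apply, Nat.cast_ofNat, Nat.add_one_sub_one, pow_one]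
    ring
  have hvc : ContinuousOn v (Icc 0 1) := fun x hx => (hv x hx).continuousWithinAt
  have key := intervalIntegral.integral_le_sub_of_hasDeriv_right_of_le zero_le_one
    (fun x hx => (hderiv x hx).continuousWithinAt)
    (fun x hx => ((hderiv x (Ioo_subset_Icc_self hx)).hasDerivAt
      (Icc_mem_nhds hx.1 hx.2)).hasDerivWithinAt)
    (φ := fun x => v x * v'' x + μ ^ 2 * v x ^ 2)
    (ContinuousOn.integrableOn_Icc (by fun_prop))
    (fun x _ => le_add_of_nonneg_right (sq_nonneg _))
  refine key.trans (le_of_eq ?_)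
  simp only [mul_one, mul_zero, Real.tan_zero, h0, hroot]
  linear_combination v 1 * h1

theorem zero_input_decay_estimate (ε q lam μ : ℝ) (hε : 0 < ε) (hq : 0 < q)
    (hμ : μ ∈ Ioo 0 (π / 2)) (hroot : μ * Real.tan μ = q)
    (u ut ux uxx : ℝ → ℝ → ℝ)
    (hreg : ClassicalReg (Ici 0) u ut ux uxx)
    (hpde : ∀ x ∈ Ioo (0:ℝ) 1, ∀ t ∈ Ici (0:ℝ), ut x t = ε * uxx x t + lam * u x t)
    (hbc0 : ∀ t ∈ Ici (0:ℝ), ux 0 t = 0)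
    (hbc1 : ∀ t ∈ Ici (0:ℝ), ux 1 t + q * u 1 t = 0) :
    ∀ t ≥ (0:ℝ), Real.sqrt (∫ x in (0:ℝ)..1, (u x t) ^ 2) ≤
      Real.exp ((lam - ε * μ ^ 2) * t) * Real.sqrt (∫ x in (0:ℝ)..1, (u x 0) ^ 2) := by
  intro t ht
  have ht : 0 ≤ t := ht
  set c := lam - ε * μ ^ 2 with hc
  have hsub : Icc (0:ℝ) 1 ×ˢ Icc 0 t ⊆ Icc (0:ℝ) 1 ×ˢ Ici 0 :=
    prod_mono_right Icc_subset_Ici_self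
  have slice : ∀ {f : ℝ → ℝ → ℝ},
      ContinuousOn (fun p : ℝ × ℝ => f p.1 p.2) (Icc 0 1 ×ˢ Ici 0) →
      ∀ s ∈ Ici (0:ℝ), ContinuousOn (fun x => f x s) (Icc 0 1) := fun hf s hs =>
    hf.comp (by fun_prop : ContinuousOn (fun x : ℝ => (x, s)) (Icc 0 1)) fun x hx => ⟨hx, hs⟩
  set W : ℝ → ℝ → ℝ := fun x s =>
    Real.exp (-(2 * c) * s) * (2 * (u x s * ut x s - c * u x s ^ 2)) with hW
  have hWc : ContinuousOn (fun p : ℝ × ℝ => W p.1 p.2) (Icc 0 1 ×ˢ Icc 0 t) := by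
    have h1 := hreg.cont.mono hsub
    have h2 := hreg.cont_ut.mono hsub
    simp only [hW]
    fun_prop
  have hFTC : ∀ x ∈ Icc (0:ℝ) 1,
      ∫ s in (0:ℝ)..t, W x s = Real.exp (-(2 * c) * t) * u x t ^ 2 - u x 0 ^ 2 := by
    intro x hx
    have hd : ∀ s ∈ Ici (0:ℝ),
        HasDerivWithinAt (fun s => Real.exp (-(2 * c) * s) * u x s ^ 2) (W x s) (Ici 0) s := by
      intro s hs
      have h := ((((hasDerivAt_id s).const_mul (-(2 * c))).exp).hasDerivWithinAt
        (s := Ici 0)).mul ((hreg.deriv_t x hx s hs).pow 2)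
      refine h.congr_deriv ?_
      simp only [hW, id_eq, Pi.pow_apply, Nat.cast_ofNat, Nat.add_one_sub_one, pow_one]
      ring
    have hint : IntervalIntegrable (W x) volume 0 t := by
      refine ContinuousOn.intervalIntegrable_of_Icc ht ?_
      exact hWc.comp (by fun_prop : ContinuousOn (fun s : ℝ => (x, s)) (Icc 0 t))
        fun s hs => ⟨hx, hs⟩
    rw [intervalIntegral.integral_eq_sub_of_hasDerivAt_of_le ht
      (fun s hs => (hd s hs.1).continuousWithinAt.mono Icc_subset_Ici_self)
      (fun s hs => (hd s hs.1.le).hasDerivAt (Ici_mem_nhds hs.1)) hint]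
    simp
  have hslope : ∀ s ∈ Ici (0:ℝ), ∫ x in (0:ℝ)..1, W x s ≤ 0 := by
    intro s hs
    have h : ∫ x in (0:ℝ)..1, W x s = ∫ x in (0:ℝ)..1,
        (Real.exp (-(2 * c) * s) * (2 * ε)) * (u x s * uxx x s + μ ^ 2 * u x s ^ 2) := by
      refine intervalIntegral.integral_congr_Ioo_of_le zero_le_one fun x hx => ?_
      simp only [hW, hpde x hx s hs, hc]
      ring
    rw [h, intervalIntegral.integral_const_mul]
    exact mul_nonpos_of_nonneg_of_nonpos (by positivity)
      (integral_mul_second_deriv_add_sq_nonpos hμ hroot (fun x hx => hreg.deriv_x x hx s hs)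
        (fun x hx => hreg.deriv_xx x hx s hs) (slice hreg.cont_uxx s hs) (hbc0 s hs) (hbc1 s hs))
  have hswap : ∫ x in (0:ℝ)..1, ∫ s in (0:ℝ)..t, W x s =
      ∫ s in (0:ℝ)..t, ∫ x in (0:ℝ)..1, W x s := by
    refine intervalIntegral_intervalIntegral_swap ?_
    rw [uIoc_of_le zero_le_one, uIoc_of_le ht]
    exact (hWc.integrableOn_compact (isCompact_Icc.prod isCompact_Icc)).mono_set
      (prod_mono Ioc_subset_Icc_self Ioc_subset_Icc_self)
  have hle : ∫ x in (0:ℝ)..1, ∫ s in (0:ℝ)..t, W x s ≤ 0 := by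
    rw [hswap]
    have := intervalIntegral.integral_nonneg ht (μ := volume)
      (f := fun s => -∫ x in (0:ℝ)..1, W x s) fun s hs => neg_nonneg.2 (hslope s hs.1)
    rw [intervalIntegral.integral_neg] at this
    linarith
  have hsq : ∀ s ∈ Ici (0:ℝ), IntervalIntegrable (fun x => u x s ^ 2) volume 0 1 := fun s hs =>
    ((slice hreg.cont s hs).pow 2).intervalIntegrable_of_Icc zero_le_one
  have henergy : Real.exp (-(2 * c) * t) * ∫ x in (0:ℝ)..1, u x t ^ 2 ≤
      ∫ x in (0:ℝ)..1, u x 0 ^ 2 := by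
    rw [intervalIntegral.integral_congr (g := fun x =>
        Real.exp (-(2 * c) * t) * u x t ^ 2 - u x 0 ^ 2)
        (fun x hx => hFTC x (by rwa [uIcc_of_le zero_le_one] at hx)),
      intervalIntegral.integral_sub ((hsq t ht).const_mul _) (hsq 0 self_mem_Ici),
      intervalIntegral.integral_const_mul] at hle
    linarith
  rw [← Real.sqrt_sq (Real.exp_pos (c * t)).le, ← Real.sqrt_mul (sq_nonneg _)]
  refine Real.sqrt_le_sqrt ?_
  calc ∫ x in (0:ℝ)..1, u x t ^ 2
      = Real.exp (c * t) ^ 2 * (Real.exp (-(2 * c) * t) * ∫ x in (0:ℝ)..1, u x t ^ 2) := by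
        rw [← mul_assoc, ← Real.exp_nat_mul, ← Real.exp_add]
        ring_nf
        simp
    _ ≤ _ := mul_le_mul_of_nonneg_left henergy (sq_nonneg _)
end

section
/- Let ε, λ > 0 and define K : ℝ² → ℝ by K(x,y) = −(λ/(2ε))·x·∑_{n=0}^∞ (λ(x²−y²)/(4ε))ⁿ/(n!·(n+1)!) (this equals −(λ/ε)·x·I₁(z)/z with z = √(λ(x²−y²)/ε), where I₁ is the modified Bessel function of the first kind of order one). Then K is infinitely differentiable on ℝ² and satisfies K_xx(x,y) − K_yy(x,y) = (λ/ε)·K(x,y) for all (x,y) ∈ ℝ², K_y(x,0) = 0 for all x ∈ ℝ, and K(x,x) = −(λ/(2ε))·x for all x ∈ ℝ. -/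
open Real Set

/-- The entire function `∑ sⁿ / (n! (n + k)!)`, a rescaled modified Bessel function of order `k`. -/
noncomputable def besselSeries (k : ℕ) (s : ℝ) : ℝ :=
  ∑' n : ℕ, s ^ n / (Nat.factorial n * Nat.factorial (n + k) : ℝ)

lemma norm_besselSeries_term_le (k n : ℕ) (s : ℝ) :
    ‖s ^ n / (Nat.factorial n * Nat.factorial (n + k) : ℝ)‖ ≤ |s| ^ n / Nat.factorial n := by
  have h : (1 : ℝ) ≤ Nat.factorial (n + k) := by exact_mod_cast Nat.factorial_pos (n + k)
  have h' : (0 : ℝ) < Nat.factorial n := by exact_mod_cast Nat.factorial_pos n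
  rw [norm_div, norm_pow, Real.norm_eq_abs, Real.norm_of_nonneg (by positivity)]
  gcongr
  nlinarith

lemma summable_besselSeries (k : ℕ) (s : ℝ) :
    Summable fun n : ℕ => s ^ n / (Nat.factorial n * Nat.factorial (n + k) : ℝ) :=
  .of_norm_bounded (Real.summable_pow_div_factorial |s|)
    fun n => norm_besselSeries_term_le k n s

lemma deriv_coeff_besselSeries (k n : ℕ) (s : ℝ) :
    ((n + 1 : ℕ) * s ^ (n + 1 - 1)) / (Nat.factorial (n + 1) * Nat.factorial (n + 1 + k) : ℝ) =
      s ^ n / (Nat.factorial n * Nat.factorial (n + (k + 1)) : ℝ) := by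
  have h₁ : (Nat.factorial n : ℝ) ≠ 0 := by positivity
  have h₂ : (Nat.factorial (n + (k + 1)) : ℝ) ≠ 0 := by positivity
  rw [Nat.add_right_comm n 1 k, add_assoc n k 1, Nat.factorial_succ n, Nat.add_sub_cancel]
  push_cast
  field_simp

lemma hasDerivAt_besselSeries (k : ℕ) (s : ℝ) :
    HasDerivAt (besselSeries k) (besselSeries (k + 1) s) s := by
  set R : ℝ := |s| + 1
  have hs : s ∈ Metric.ball (0 : ℝ) R := by simp [R]
  have hu : Summable fun n : ℕ => (R ^ (n - 1) / Nat.factorial (n - 1) : ℝ) :=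
    (summable_nat_add_iff 1).1 (by simpa using Real.summable_pow_div_factorial R)
  have key := hasDerivAt_tsum_of_isPreconnected
    (g := fun (n : ℕ) (t : ℝ) => t ^ n / (Nat.factorial n * Nat.factorial (n + k) : ℝ))
    (g' := fun (n : ℕ) (t : ℝ) =>
      (n * t ^ (n - 1)) / (Nat.factorial n * Nat.factorial (n + k) : ℝ))
    hu Metric.isOpen_ball (convex_ball (0 : ℝ) R).isPreconnected
    (fun n t _ => (hasDerivAt_pow n t).div_const _)
    (fun n t ht => by
      rcases n with _ | n
      · simp
      · rw [deriv_coeff_besselSeries]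
        refine (norm_besselSeries_term_le _ _ _).trans ?_
        have : |t| ≤ R := by simpa using (mem_ball_zero_iff.1 ht).le
        simp only [Nat.add_sub_cancel]
        gcongr)
    hs (summable_besselSeries k s) hs
  have hsum : Summable fun n : ℕ =>
      (n * s ^ (n - 1)) / (Nat.factorial n * Nat.factorial (n + k) : ℝ) := by
    refine (summable_nat_add_iff 1).1 ?_
    simp only [deriv_coeff_besselSeries]
    exact summable_besselSeries (k + 1) s
  rw [hsum.tsum_eq_zero_add] at key
  simp only [deriv_coeff_besselSeries, Nat.cast_zero, zero_mul, zero_div, zero_add] at key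
  exact key

lemma contDiff_besselSeries (k : ℕ) : ContDiff ℝ (⊤ : ℕ∞) (besselSeries k) := by
  refine contDiff_infty.2 fun n => ?_
  induction n generalizing k with
  | zero =>
    exact contDiff_zero.2
      (continuous_iff_continuousAt.2 fun s => (hasDerivAt_besselSeries k s).continuousAt)
  | succ n ih =>
    push_cast
    refine contDiff_succ_iff_deriv.2
      ⟨fun s => (hasDerivAt_besselSeries k s).differentiableAt, by simp, ?_⟩
    rw [funext fun s => (hasDerivAt_besselSeries k s).deriv]
    exact ih (k + 1)

lemma besselSeries_recurrence (k : ℕ) (s : ℝ) :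
    s * besselSeries (k + 2) s + (k + 1) * besselSeries (k + 1) s = besselSeries k s := by
  unfold besselSeries
  rw [(summable_besselSeries k s).tsum_eq_zero_add,
    (summable_besselSeries (k + 1) s).tsum_eq_zero_add, mul_add, ← tsum_mul_left,
    ← tsum_mul_left, add_left_comm, ← Summable.tsum_add
      ((summable_besselSeries (k + 2) s).mul_left s)
      (((summable_nat_add_iff 1).2 (summable_besselSeries (k + 1) s)).mul_left _)]
  congr 1
  · rw [zero_add, zero_add, Nat.factorial_succ k]
    push_cast
    have : (Nat.factorial k : ℝ) ≠ 0 := by positivity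
    field_simp
  · refine tsum_congr fun n => ?_
    have e₁ : n + (k + 2) = (n + k + 1) + 1 := by ring
    have e₂ : n + 1 + (k + 1) = (n + k + 1) + 1 := by ring
    have e₃ : n + 1 + k = n + k + 1 := by ring
    rw [e₁, e₂, e₃, Nat.factorial_succ (n + k + 1), Nat.factorial_succ n]
    push_cast
    have h₁ : (Nat.factorial n : ℝ) ≠ 0 := by positivity
    have h₂ : (Nat.factorial (n + k + 1) : ℝ) ≠ 0 := by positivity
    have h₃ : (n + k + 1 + 1 : ℝ) ≠ 0 := by positivity
    field_simp
    ring

lemma besselSeries_one_zero : besselSeries 1 0 = 1 := by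
  unfold besselSeries
  rw [tsum_eq_single 0 fun n hn => by simp [hn]]
  simp

lemma hasDerivAt_besselSeries_comp_fst (k : ℕ) (a x y : ℝ) :
    HasDerivAt (fun r => besselSeries k (a * (r ^ 2 - y ^ 2)))
      (besselSeries (k + 1) (a * (x ^ 2 - y ^ 2)) * (2 * a * x)) x := by
  have h : HasDerivAt (fun r : ℝ => a * (r ^ 2 - y ^ 2)) (2 * a * x) x := by
    refine (((hasDerivAt_pow 2 x).sub_const (y ^ 2)).const_mul a).congr_deriv ?_
    norm_num
    ring
  exact (hasDerivAt_besselSeries k _).comp x h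

lemma hasDerivAt_besselSeries_comp_snd (k : ℕ) (a x y : ℝ) :
    HasDerivAt (fun r => besselSeries k (a * (x ^ 2 - r ^ 2)))
      (besselSeries (k + 1) (a * (x ^ 2 - y ^ 2)) * (-2 * a * y)) y := by
  have h : HasDerivAt (fun r : ℝ => a * (x ^ 2 - r ^ 2)) (-2 * a * y) y := by
    refine (((hasDerivAt_pow 2 y).const_sub (x ^ 2)).const_mul a).congr_deriv ?_
    norm_num
    ring
  exact (hasDerivAt_besselSeries k _).comp y h

theorem controller_kernel_properties (ε lam : ℝ) (hε : 0 < ε) (hlam : 0 < lam)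
    (K : ℝ → ℝ → ℝ)
    (hK : ∀ x y : ℝ, K x y = -(lam / (2 * ε)) * x *
      ∑' n : ℕ, (lam * (x ^ 2 - y ^ 2) / (4 * ε)) ^ n /
        (Nat.factorial n * Nat.factorial (n + 1) : ℝ)) :
    ContDiff ℝ (⊤ : ℕ∞) (fun p : ℝ × ℝ => K p.1 p.2) ∧
    (∀ x y : ℝ,
      deriv (fun s => deriv (fun r => K r y) s) x
        - deriv (fun s => deriv (fun r => K x r) s) y = lam / ε * K x y) ∧
    (∀ x : ℝ, deriv (fun r => K x r) 0 = 0) ∧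
    (∀ x : ℝ, K x x = -(lam / (2 * ε)) * x) := by
  obtain ⟨a, ha⟩ : ∃ a, a = lam / (4 * ε) := ⟨_, rfl⟩
  obtain ⟨c, hc⟩ : ∃ c, c = -(lam / (2 * ε)) := ⟨_, rfl⟩
  have hK' : ∀ x y, K x y = c * x * besselSeries 1 (a * (x ^ 2 - y ^ 2)) := fun x y => by
    rw [hK, ha, hc, div_mul_eq_mul_div]
    rfl
  have h4a : lam / ε = 4 * a := by
    rw [ha]
    field_simp
  have hy : ∀ x y, deriv (fun r => K x r) y =
      c * x * (besselSeries 2 (a * (x ^ 2 - y ^ 2)) * (-2 * a * y)) := fun x y => by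
    simp only [hK']
    exact ((hasDerivAt_besselSeries_comp_snd 1 a x y).const_mul (c * x)).deriv
  have hx : ∀ x y, deriv (fun r => K r y) x = c * besselSeries 1 (a * (x ^ 2 - y ^ 2)) +
      c * x * (besselSeries 2 (a * (x ^ 2 - y ^ 2)) * (2 * a * x)) := fun x y => by
    simp only [hK']
    refine (HasDerivAt.fun_mul ?_ (hasDerivAt_besselSeries_comp_fst 1 a x y)).deriv
    simpa using (hasDerivAt_id x).const_mul c
  refine ⟨?_, fun x y => ?_, fun x => ?_, fun x => ?_⟩
  · simp only [hK']
    have := contDiff_besselSeries 1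
    fun_prop
  · have hlin : ∀ b z : ℝ, HasDerivAt (fun r => b * r) b z := fun b z => by
      simpa using (hasDerivAt_id z).const_mul b
    have hxx := ((hasDerivAt_besselSeries_comp_fst 1 a x y).const_mul c).fun_add
      ((hlin c x).fun_mul ((hasDerivAt_besselSeries_comp_fst 2 a x y).fun_mul (hlin (2 * a) x)))
    have hyy := ((hasDerivAt_besselSeries_comp_snd 2 a x y).fun_mul
      (hlin (-2 * a) y)).const_mul (c * x)
    have hrec := besselSeries_recurrence 1 (a * (x ^ 2 - y ^ 2))
    simp only [hx, hy]
    rw [hxx.deriv, hyy.deriv, hK', h4a, ← hrec]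
    push_cast
    ring
  · simp [hy]
  · simp [hK', besselSeries_one_zero, hc]
end

section
/- Let ε, λ, q > 0, let k : [0,1] → ℝ be twice continuously differentiable with k′(0) = 0, let p₁ : [0,1] → ℝ and ξ : I → ℝ be continuous, and let Ū ∈ ℝ. Let û be a classical solution on [0,1]×I of û_t(x,t) = ε û_xx(x,t) + λ û(x,t) + p₁(x)·ξ(t) with boundary conditions û_x(0,t) = −(λ/(2ε))·ξ(t) and û_x(1,t) + q·û(1,t) = Ū. Define d(t) = Ū − ∫₀¹ k(y)·û(y,t) dy. Then d is differentiable on the interior of I and d′(t) = −ε·k(1)·d(t) + (ε·q·k(1) + ε·k′(1))·û(1,t) − ∫₀¹ (ε·k″(y) + ε·k(1)·k(y) + λ·k(y))·û(y,t) dy − ((λ·k(0))/2 + ∫₀¹ k(y)·p₁(y) dy)·ξ(t). -/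
open Real Set

open MeasureTheory in
/-- Differentiation under the integral sign for an integrand that is continuous together with its
time derivative on `[a, b] × I`. -/
theorem hasDerivAt_intervalIntegral_of_continuousOn {a b : ℝ} (hab : a ≤ b) {I : Set ℝ}
    {F F' : ℝ → ℝ → ℝ}
    (hF : ContinuousOn (fun p : ℝ × ℝ => F p.1 p.2) (Icc a b ×ˢ I))
    (hF' : ContinuousOn (fun p : ℝ × ℝ => F' p.1 p.2) (Icc a b ×ˢ I))
    (hderiv : ∀ x ∈ Icc a b, ∀ t ∈ I, HasDerivWithinAt (F x) (F' x t) I t)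
    {t : ℝ} (ht : t ∈ interior I) :
    HasDerivAt (fun s => ∫ x in a..b, F x s) (∫ x in a..b, F' x t) t := by
  obtain ⟨δ, hδ, hδI⟩ := Metric.nhds_basis_closedBall.mem_iff.1 (isOpen_interior.mem_nhds ht)
  have hδI' : Metric.closedBall t δ ⊆ I := hδI.trans interior_subset
  have hmem : ∀ x ∈ uIoc a b, x ∈ Icc a b := fun x hx =>
    Ioc_subset_Icc_self (uIoc_of_le hab ▸ hx)
  have hslice : ∀ G : ℝ → ℝ → ℝ,
      ContinuousOn (fun p : ℝ × ℝ => G p.1 p.2) (Icc a b ×ˢ I) → ∀ s ∈ I,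
      IntervalIntegrable (fun x => G x s) volume a b := fun G hG s hs =>
    ContinuousOn.intervalIntegrable_of_Icc hab <|
      hG.comp (f := fun x => (x, s)) (by fun_prop) fun x hx => ⟨hx, hs⟩
  obtain ⟨C, hC⟩ := (isCompact_Icc.prod (isCompact_closedBall t δ)).exists_bound_of_continuousOn
    (hF'.mono (prod_mono_right hδI'))
  have hball : Metric.ball t δ ∈ nhds t := Metric.ball_mem_nhds t hδ
  have htI : t ∈ I := interior_subset ht
  refine (intervalIntegral.hasDerivAt_integral_of_dominated_loc_of_deriv_le
    (F := fun s x => F x s) (F' := fun s x => F' x s) (bound := fun _ => C) hball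
    ?_ (hslice F hF t htI) (hslice F' hF' t htI).def'.aestronglyMeasurable ?_
    intervalIntegrable_const ?_).2
  · filter_upwards [isOpen_interior.mem_nhds ht] with s hs
    exact (hslice F hF s (interior_subset hs)).def'.aestronglyMeasurable
  · exact .of_forall fun x hx s hs =>
      hC (x, s) ⟨hmem x hx, Metric.ball_subset_closedBall hs⟩
  · refine .of_forall fun x hx s hs => ?_
    have hsI : s ∈ interior I := hδI (Metric.ball_subset_closedBall hs)
    exact (hderiv x (hmem x hx) s (interior_subset hsI)).hasDerivAt
      (mem_interior_iff_mem_nhds.1 hsI)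

/-- Green's second identity on `[a, b]`: two integrations by parts. -/
theorem integral_mul_deriv_deriv_eq {a b : ℝ} (hab : a ≤ b) {f f' f'' g g' g'' : ℝ → ℝ}
    (hf : ∀ x ∈ Icc a b, HasDerivWithinAt f (f' x) (Icc a b) x)
    (hf' : ∀ x ∈ Icc a b, HasDerivWithinAt f' (f'' x) (Icc a b) x)
    (hf'' : ContinuousOn f'' (Icc a b))
    (hg : ∀ x ∈ Icc a b, HasDerivWithinAt g (g' x) (Icc a b) x)
    (hg' : ∀ x ∈ Icc a b, HasDerivWithinAt g' (g'' x) (Icc a b) x)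
    (hg'' : ContinuousOn g'' (Icc a b)) :
    ∫ x in a..b, f x * g'' x =
      f b * g' b - f a * g' a - (f' b * g b - f' a * g a) + ∫ x in a..b, f'' x * g x := by
  have hf'i : IntervalIntegrable f' MeasureTheory.volume a b :=
    ContinuousOn.intervalIntegrable_of_Icc hab fun x hx => (hf' x hx).continuousWithinAt
  have hg'i : IntervalIntegrable g' MeasureTheory.volume a b :=
    ContinuousOn.intervalIntegrable_of_Icc hab fun x hx => (hg' x hx).continuousWithinAt
  have hf''i := hf''.intervalIntegrable_of_Icc (μ := MeasureTheory.volume) hab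
  have hg''i := hg''.intervalIntegrable_of_Icc (μ := MeasureTheory.volume) hab
  rw [← uIcc_of_le hab] at hf hf' hg hg'
  rw [intervalIntegral.integral_mul_deriv_eq_deriv_mul_of_hasDerivWithinAt hf hg' hf'i hg''i,
    intervalIntegral.integral_mul_deriv_eq_deriv_mul_of_hasDerivWithinAt hf' hg hf''i hg'i]
  ring

theorem input_holding_error_derivative (ε lam q : ℝ)
    (hε : 0 < ε) (hlam : 0 < lam) (hq : 0 < q)
    -- `k`, twice continuously differentiable on `[0,1]` with `k'(0) = 0`
    (k k' k'' : ℝ → ℝ)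
    (hk' : ∀ x ∈ Icc (0:ℝ) 1, HasDerivWithinAt k (k' x) (Icc 0 1) x)
    (hk'' : ∀ x ∈ Icc (0:ℝ) 1, HasDerivWithinAt k' (k'' x) (Icc 0 1) x)
    (hk''c : ContinuousOn k'' (Icc 0 1))
    (hk'0 : k' 0 = 0)
    (I : Set ℝ) (p₁ : ℝ → ℝ) (hp₁ : ContinuousOn p₁ (Icc 0 1))
    (ξ : ℝ → ℝ) (hξ : ContinuousOn ξ I)
    (Ubar : ℝ)
    -- `u = û` is a classical solution of the observer system with held input `Ubar`
    (u ut ux uxx : ℝ → ℝ → ℝ)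
    (hreg : ClassicalReg I u ut ux uxx)
    (hpde : ∀ x ∈ Ioo (0:ℝ) 1, ∀ t ∈ I, ut x t = ε * uxx x t + lam * u x t + p₁ x * ξ t)
    (hbc0 : ∀ t ∈ I, ux 0 t = -(lam / (2 * ε)) * ξ t)
    (hbc1 : ∀ t ∈ I, ux 1 t + q * u 1 t = Ubar)
    -- the input holding error
    (d : ℝ → ℝ) (hd : ∀ t, d t = Ubar - ∫ y in (0:ℝ)..1, k y * u y t) :
    ∀ t ∈ interior I, HasDerivAt d
      (-ε * k 1 * d t + (ε * q * k 1 + ε * k' 1) * u 1 t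
        - (∫ y in (0:ℝ)..1, (ε * k'' y + ε * k 1 * k y + lam * k y) * u y t)
        - (lam * k 0 / 2 + ∫ y in (0:ℝ)..1, k y * p₁ y) * ξ t) t := by
  intro t ht
  have htI : t ∈ I := interior_subset ht
  have hkc : ContinuousOn k (Icc 0 1) := fun x hx => (hk' x hx).continuousWithinAt
  have hkc' : ContinuousOn (fun p : ℝ × ℝ => k p.1) (Icc 0 1 ×ˢ I) :=
    hkc.comp continuousOn_fst fun p hp => hp.1
  have hderiv := hasDerivAt_intervalIntegral_of_continuousOn zero_le_one
    (F := fun x s => k x * u x s) (F' := fun x s => k x * ut x s)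
    (hkc'.mul hreg.cont) (hkc'.mul hreg.cont_ut)
    (fun x hx s hs => (hreg.deriv_t x hx s hs).const_mul (k x)) ht
  have hd_deriv : HasDerivAt d (-∫ y in (0:ℝ)..1, k y * ut y t) t := by
    rw [funext hd]
    exact hderiv.const_sub Ubar
  have huc : ContinuousOn (fun x => u x t) (Icc 0 1) := fun x hx =>
    (hreg.deriv_x x hx t htI).continuousWithinAt
  have huxxc : ContinuousOn (fun x => uxx x t) (Icc 0 1) :=
    hreg.cont_uxx.comp (f := fun x => (x, t)) (by fun_prop) fun x hx => ⟨hx, htI⟩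
  have hint : ∀ {f g : ℝ → ℝ}, ContinuousOn f (Icc 0 1) → ContinuousOn g (Icc 0 1) →
      IntervalIntegrable (fun y => f y * g y) MeasureTheory.volume 0 1 := fun hf hg =>
    (hf.mul hg).intervalIntegrable_of_Icc zero_le_one
  have hpde_int : ∫ y in (0:ℝ)..1, k y * ut y t =
      ε * (∫ y in (0:ℝ)..1, k y * uxx y t) + lam * (∫ y in (0:ℝ)..1, k y * u y t)
        + (∫ y in (0:ℝ)..1, k y * p₁ y) * ξ t := by
    rw [← intervalIntegral.integral_const_mul, ← intervalIntegral.integral_const_mul,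
      ← intervalIntegral.integral_mul_const,
      ← intervalIntegral.integral_add ((hint hkc huxxc).const_mul ε)
        ((hint hkc huc).const_mul lam),
      ← intervalIntegral.integral_add (((hint hkc huxxc).const_mul ε).add
        ((hint hkc huc).const_mul lam)) ((hint hkc hp₁).mul_const (ξ t))]
    refine intervalIntegral.integral_congr_Ioo_of_le zero_le_one fun y hy => ?_
    simp only [hpde y hy t htI]
    ring
  have hgreen := integral_mul_deriv_deriv_eq zero_le_one hk' hk'' hk''c
    (fun x hx => hreg.deriv_x x hx t htI) (fun x hx => hreg.deriv_xx x hx t htI) huxxc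
  have hsplit : ∫ y in (0:ℝ)..1, (ε * k'' y + ε * k 1 * k y + lam * k y) * u y t =
      ε * (∫ y in (0:ℝ)..1, k'' y * u y t)
        + (ε * k 1 + lam) * (∫ y in (0:ℝ)..1, k y * u y t) := by
    rw [← intervalIntegral.integral_const_mul, ← intervalIntegral.integral_const_mul,
      ← intervalIntegral.integral_add ((hint hk''c huc).const_mul ε)
        ((hint hkc huc).const_mul (ε * k 1 + lam))]
    congr 1 with y
    ring
  convert hd_deriv using 1
  rw [hpde_int, hgreen, hsplit, hd t, hbc0 t htI, eq_sub_of_add_eq (hbc1 t htI), hk'0]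
  field_simp
  ring
end

section
/- Let ε, λ, q > 0, let k : [0,1] → ℝ be twice continuously differentiable with k′(0) = 0, let p₁ : [0,1] → ℝ and ξ : I → ℝ be continuous, let Ū ∈ ℝ, and let L : T → ℝ be continuous on the closed triangle T. Let û be a classical solution on [0,1]×I of û_t(x,t) = ε û_xx(x,t) + λ û(x,t) + p₁(x)·ξ(t) with boundary conditions û_x(0,t) = −(λ/(2ε))·ξ(t) and û_x(1,t) + q·û(1,t) = Ū, and suppose ŵ : [0,1]×I → ℝ is continuous with û(x,t) = ŵ(x,t) + ∫₀ˣ L(x,y)·ŵ(y,t) dy for all (x,t). Define d(t) = Ū − ∫₀¹ k(y)·û(y,t) dy. Then for every t in the interior of I, (d′(t))² ≤ ρ₁·d(t)² + α₁·‖ŵ[t]‖² + α₂·ŵ(1,t)² + α₃·ξ(t)², where ρ₁ = 6 ε² k(1)², α₁ = 3·(1 + (∫₀¹∫₀ˣ L(x,y)² dy dx)^{1/2})²·∫₀¹ (ε k″(y) + ε k(1) k(y) + λ k(y))² dy + 6·(ε q k(1) + ε k′(1))²·∫₀¹ L(1,y)² dy, α₂ = 6·(ε q k(1) + ε k′(1))²,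 and α₃ = 6·((λ k(0))/2 + ∫₀¹ k(y) p₁(y) dy)². -/
open Real Set

/-- The closed triangle `T = {(x,y) : 0 ≤ y ≤ x ≤ 1}`. -/
def Tri : Set (ℝ × ℝ) := {p : ℝ × ℝ | 0 ≤ p.2 ∧ p.2 ≤ p.1 ∧ p.1 ≤ 1}

section Helpers

open MeasureTheory Topology

/-- Cauchy–Schwarz inequality for interval integrals of continuous functions. -/
theorem sq_integral_mul_le {a b : ℝ} (hab : a ≤ b) {f g : ℝ → ℝ}
    (hf : ContinuousOn f (Icc a b)) (hg : ContinuousOn g (Icc a b)) :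
    (∫ x in a..b, f x * g x) ^ 2 ≤ (∫ x in a..b, f x ^ 2) * ∫ x in a..b, g x ^ 2 := by
  have hff : IntervalIntegrable (fun x => f x ^ 2) volume a b :=
    (hf.pow 2).intervalIntegrable_of_Icc hab
  have hgg : IntervalIntegrable (fun x => g x ^ 2) volume a b :=
    (hg.pow 2).intervalIntegrable_of_Icc hab
  have hfg : IntervalIntegrable (fun x => f x * g x) volume a b :=
    (hf.mul hg).intervalIntegrable_of_Icc hab
  have hquad : ∀ s : ℝ, 0 ≤ (∫ x in a..b, f x ^ 2) * (s * s)
      + (2 * ∫ x in a..b, f x * g x) * s + ∫ x in a..b, g x ^ 2 := by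
    intro s
    have hexp : ∫ x in a..b, (s * f x + g x) ^ 2
        = (∫ x in a..b, f x ^ 2) * (s * s)
          + (2 * ∫ x in a..b, f x * g x) * s + ∫ x in a..b, g x ^ 2 := by
      have hpt : ∀ x, (s * f x + g x) ^ 2
          = (s * s) * f x ^ 2 + (2 * s) * (f x * g x) + g x ^ 2 := fun x => by ring
      simp_rw [hpt]
      rw [intervalIntegral.integral_add ((hff.const_mul _).add (hfg.const_mul _)) hgg,
        intervalIntegral.integral_add (hff.const_mul _) (hfg.const_mul _),
        intervalIntegral.integral_const_mul, intervalIntegral.integral_const_mul]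
      ring
    rw [← hexp]
    exact intervalIntegral.integral_nonneg hab fun x _ => sq_nonneg _
  have hdisc := discrim_le_zero hquad
  rw [discrim] at hdisc
  linarith

/-- `L²` bound for a Volterra operator of the second kind with globally continuous data. -/
theorem integral_sq_add_volterra_le_of_continuous {L : ℝ → ℝ → ℝ} (hL : Continuous L.uncurry)
    {f : ℝ → ℝ} (hf : Continuous f) :
    ∫ x in (0:ℝ)..1, (f x + ∫ y in (0:ℝ)..x, L x y * f y) ^ 2
      ≤ (1 + √(∫ x in (0:ℝ)..1, ∫ y in (0:ℝ)..x, L x y ^ 2)) ^ 2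
        * ∫ x in (0:ℝ)..1, f x ^ 2 := by
  set m := ∫ x in (0:ℝ)..1, ∫ y in (0:ℝ)..x, L x y ^ 2 with hm
  set W := ∫ x in (0:ℝ)..1, f x ^ 2 with hW
  have hLx : ∀ x, Continuous (L x) := fun x => hL.comp (by fun_prop : Continuous fun y => (x, y))
  have hv : Continuous fun x => ∫ y in (0:ℝ)..x, L x y * f y := by
    refine intervalIntegral.continuous_parametric_intervalIntegral_of_continuous
      (f := fun x y => L x y * f y) ?_ continuous_id
    exact hL.mul (hf.comp continuous_snd)
  have hM : Continuous fun x => ∫ y in (0:ℝ)..x, L x y ^ 2 := by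
    refine intervalIntegral.continuous_parametric_intervalIntegral_of_continuous
      (f := fun x y => L x y ^ 2) ?_ continuous_id
    exact hL.pow 2
  set v : ℝ → ℝ := fun x => ∫ y in (0:ℝ)..x, L x y * f y with hvdef
  have hW0 : 0 ≤ W := intervalIntegral.integral_nonneg zero_le_one fun x _ => sq_nonneg _
  have hM0 : ∀ x ∈ Icc (0:ℝ) 1, 0 ≤ ∫ y in (0:ℝ)..x, L x y ^ 2 := fun x hx =>
    intervalIntegral.integral_nonneg hx.1 fun y _ => sq_nonneg _
  have hm0 : 0 ≤ m := intervalIntegral.integral_nonneg zero_le_one hM0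
  have hvsq : ∀ x ∈ Icc (0:ℝ) 1, v x ^ 2 ≤ (∫ y in (0:ℝ)..x, L x y ^ 2) * W := by
    intro x hx
    refine (sq_integral_mul_le hx.1 (hLx x).continuousOn hf.continuousOn).trans ?_
    refine mul_le_mul_of_nonneg_left ?_ (hM0 x hx)
    exact intervalIntegral.integral_mono_interval le_rfl hx.1 hx.2
      (ae_of_all _ fun y => sq_nonneg (f y)) ((hf.pow 2).intervalIntegrable _ _)
  have hV : ∫ x in (0:ℝ)..1, v x ^ 2 ≤ m * W := by
    rw [hm, ← intervalIntegral.integral_mul_const]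
    exact intervalIntegral.integral_mono_on zero_le_one ((hv.pow 2).intervalIntegrable _ _)
      ((hM.mul continuous_const).intervalIntegrable _ _) hvsq
  have hcross : ∫ x in (0:ℝ)..1, f x * v x ≤ √m * W := by
    refine le_of_abs_le (abs_le_of_sq_le_sq ?_ (by positivity))
    calc (∫ x in (0:ℝ)..1, f x * v x) ^ 2 ≤ W * ∫ x in (0:ℝ)..1, v x ^ 2 :=
          sq_integral_mul_le zero_le_one hf.continuousOn hv.continuousOn
      _ ≤ W * (m * W) := mul_le_mul_of_nonneg_left hV hW0
      _ = (√m * W) ^ 2 := by rw [mul_pow, Real.sq_sqrt hm0]; ring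
  have hexp : ∫ x in (0:ℝ)..1, (f x + v x) ^ 2
      = W + 2 * (∫ x in (0:ℝ)..1, f x * v x) + ∫ x in (0:ℝ)..1, v x ^ 2 := by
    have hpt : ∀ x, (f x + v x) ^ 2 = f x ^ 2 + 2 * (f x * v x) + v x ^ 2 := fun x => by ring
    simp_rw [hpt]
    rw [intervalIntegral.integral_add, intervalIntegral.integral_add,
      intervalIntegral.integral_const_mul]
    all_goals exact Continuous.intervalIntegrable (by fun_prop) _ _
  rw [hexp]
  have := Real.sq_sqrt hm0
  nlinarith

/-- `L²` bound for a Volterra operator of the second kind with kernel continuous on `Tri`. -/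
theorem integral_sq_add_volterra_le {L : ℝ → ℝ → ℝ}
    (hL : ContinuousOn (fun p : ℝ × ℝ => L p.1 p.2) Tri)
    {f : ℝ → ℝ} (hf : ContinuousOn f (Icc 0 1)) :
    ∫ x in (0:ℝ)..1, (f x + ∫ y in (0:ℝ)..x, L x y * f y) ^ 2
      ≤ (1 + √(∫ x in (0:ℝ)..1, ∫ y in (0:ℝ)..x, L x y ^ 2)) ^ 2
        * ∫ x in (0:ℝ)..1, f x ^ 2 := by
  let c : ℝ → ℝ := fun x => max 0 (min x 1)
  have hc : Continuous c := by fun_prop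
  have hc01 : ∀ x, c x ∈ Icc (0:ℝ) 1 := fun x =>
    ⟨le_max_left _ _, max_le zero_le_one (min_le_right _ _)⟩
  have hceq : ∀ x ∈ Icc (0:ℝ) 1, c x = x := fun x hx => by
    simp only [c, min_eq_left hx.2, max_eq_right hx.1]
  let L' : ℝ → ℝ → ℝ := fun x y => L (c x) (min (c y) (c x))
  have hL' : Continuous L'.uncurry := by
    have hproj : Continuous fun p : ℝ × ℝ => (c p.1, min (c p.2) (c p.1)) := by fun_prop
    exact hL.comp_continuous hproj fun p =>
      ⟨le_min (hc01 _).1 (hc01 _).1, min_le_right _ _, (hc01 _).2⟩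
  have hf' : Continuous fun x => f (c x) := hf.comp_continuous hc hc01
  have hLeq : ∀ x ∈ Icc (0:ℝ) 1, ∀ y ∈ Icc (0:ℝ) x, L' x y = L x y := fun x hx y hy => by
    simp only [L', hceq x hx, hceq y ⟨hy.1, hy.2.trans hx.2⟩, min_eq_left hy.2]
  have key := integral_sq_add_volterra_le_of_continuous hL' hf'
  have e1 : ∫ x in (0:ℝ)..1, (f (c x) + ∫ y in (0:ℝ)..x, L' x y * f (c y)) ^ 2
      = ∫ x in (0:ℝ)..1, (f x + ∫ y in (0:ℝ)..x, L x y * f y) ^ 2 := by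
    refine intervalIntegral.integral_congr fun x hx => ?_
    rw [uIcc_of_le zero_le_one] at hx
    have : ∫ y in (0:ℝ)..x, L' x y * f (c y) = ∫ y in (0:ℝ)..x, L x y * f y := by
      refine intervalIntegral.integral_congr fun y hy => ?_
      rw [uIcc_of_le hx.1] at hy
      simp only [hLeq x hx y hy, hceq y ⟨hy.1, hy.2.trans hx.2⟩]
    simp only [this, hceq x hx]
  have e2 : ∫ x in (0:ℝ)..1, ∫ y in (0:ℝ)..x, L' x y ^ 2
      = ∫ x in (0:ℝ)..1, ∫ y in (0:ℝ)..x, L x y ^ 2 := by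
    refine intervalIntegral.integral_congr fun x hx => ?_
    rw [uIcc_of_le zero_le_one] at hx
    refine intervalIntegral.integral_congr fun y hy => ?_
    rw [uIcc_of_le hx.1] at hy
    simp only [hLeq x hx y hy]
  have e3 : ∫ x in (0:ℝ)..1, f (c x) ^ 2 = ∫ x in (0:ℝ)..1, f x ^ 2 := by
    refine intervalIntegral.integral_congr fun x hx => ?_
    rw [uIcc_of_le zero_le_one] at hx
    simp only [hceq x hx]
  rwa [e1, e2, e3] at key

/-- Green's second identity on `[0,1]`. -/
theorem integral_mul_second_deriv {k k' k'' v v' v'' : ℝ → ℝ}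
    (hk : ∀ x ∈ Icc (0:ℝ) 1, HasDerivWithinAt k (k' x) (Icc 0 1) x)
    (hk' : ∀ x ∈ Icc (0:ℝ) 1, HasDerivWithinAt k' (k'' x) (Icc 0 1) x)
    (hk'' : ContinuousOn k'' (Icc 0 1))
    (hv : ∀ x ∈ Icc (0:ℝ) 1, HasDerivWithinAt v (v' x) (Icc 0 1) x)
    (hv' : ∀ x ∈ Icc (0:ℝ) 1, HasDerivWithinAt v' (v'' x) (Icc 0 1) x)
    (hv'' : ContinuousOn v'' (Icc 0 1)) :
    ∫ x in (0:ℝ)..1, k x * v'' x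
      = k 1 * v' 1 - k 0 * v' 0 - (k' 1 * v 1 - k' 0 * v 0) + ∫ x in (0:ℝ)..1, k'' x * v x := by
  have hk'c : ContinuousOn k' (Icc 0 1) := fun x hx => (hk' x hx).continuousWithinAt
  have hv'c : ContinuousOn v' (Icc 0 1) := fun x hx => (hv' x hx).continuousWithinAt
  have hI : uIcc (0:ℝ) 1 = Icc 0 1 := uIcc_of_le zero_le_one
  rw [← hI] at hk hk' hv hv'
  rw [intervalIntegral.integral_mul_deriv_eq_deriv_mul_of_hasDerivWithinAt hk hv'
      (hk'c.intervalIntegrable_of_Icc zero_le_one) (hv''.intervalIntegrable_of_Icc zero_le_one),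
    intervalIntegral.integral_mul_deriv_eq_deriv_mul_of_hasDerivWithinAt hk' hv
      (hk''.intervalIntegrable_of_Icc zero_le_one) (hv'c.intervalIntegrable_of_Icc zero_le_one)]
  ring

/-- Differentiation under the integral sign for a weighted spatial average. -/
theorem hasDerivAt_integral_mul {I : Set ℝ} {k : ℝ → ℝ} (hk : ContinuousOn k (Icc 0 1))
    {u ut : ℝ → ℝ → ℝ}
    (hu : ContinuousOn (fun p : ℝ × ℝ => u p.1 p.2) (Icc 0 1 ×ˢ I))
    (hut : ContinuousOn (fun p : ℝ × ℝ => ut p.1 p.2) (Icc 0 1 ×ˢ I))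
    (hderiv : ∀ x ∈ Icc (0:ℝ) 1, ∀ t ∈ I, HasDerivWithinAt (fun s => u x s) (ut x t) I t)
    {t : ℝ} (ht : t ∈ interior I) :
    HasDerivAt (fun s => ∫ x in (0:ℝ)..1, k x * u x s) (∫ x in (0:ℝ)..1, k x * ut x t) t := by
  obtain ⟨δ, hδ, hball⟩ := Metric.mem_nhds_iff.1 (mem_interior_iff_mem_nhds.1 ht)
  have hslice : ∀ {g : ℝ → ℝ → ℝ},
      ContinuousOn (fun p : ℝ × ℝ => g p.1 p.2) (Icc 0 1 ×ˢ I) → ∀ s ∈ I,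
      ContinuousOn (fun x => k x * g x s) (Icc 0 1) := fun hg s hs =>
    hk.mul (hg.comp (f := fun x => (x, s)) (by fun_prop) fun x hx => ⟨hx, hs⟩)
  have hsub : Metric.closedBall t (δ / 2) ⊆ I :=
    (Metric.closedBall_subset_ball (by linarith)).trans hball
  obtain ⟨C, hC⟩ := ((isCompact_Icc (a := (0:ℝ)) (b := 1)).prod
    (isCompact_closedBall t (δ / 2))).exists_bound_of_continuousOn
    (f := fun p : ℝ × ℝ => k p.1 * ut p.1 p.2)
    ((hk.comp continuousOn_fst fun p hp => hp.1).mul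
      (hut.mono (prod_mono_right hsub)))
  have hmeas : ∀ {g : ℝ → ℝ}, ContinuousOn g (Icc 0 1) →
      AEStronglyMeasurable g (volume.restrict (uIoc (0:ℝ) 1)) := fun hg => by
    rw [uIoc_of_le zero_le_one]
    exact (hg.mono Ioc_subset_Icc_self).aestronglyMeasurable measurableSet_Ioc
  have hmem : ∀ {x : ℝ}, x ∈ uIoc (0:ℝ) 1 → x ∈ Icc (0:ℝ) 1 := fun hx => by
    rw [uIoc_of_le zero_le_one] at hx
    exact Ioc_subset_Icc_self hx
  have htI : t ∈ I := interior_subset ht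
  refine (intervalIntegral.hasDerivAt_integral_of_dominated_loc_of_deriv_le
    (F := fun s x => k x * u x s) (F' := fun s x => k x * ut x s) (bound := fun _ => C)
    (Metric.ball_mem_nhds t (half_pos hδ)) ?_ ?_ ?_ ?_ ?_ ?_).2
  · filter_upwards [mem_interior_iff_mem_nhds.1 ht] with s hs using hmeas (hslice hu s hs)
  · exact (hslice hu t htI).intervalIntegrable_of_Icc zero_le_one
  · exact hmeas (hslice hut t htI)
  · exact ae_of_all _ fun x hx s hs => hC (x, s) ⟨hmem hx, Metric.ball_subset_closedBall hs⟩
  · exact intervalIntegrable_const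
  · refine ae_of_all _ fun x hx s hs => ?_
    have hsI : I ∈ 𝓝 s := Filter.mem_of_superset
      (Metric.isOpen_ball.mem_nhds hs) (Metric.ball_subset_closedBall.trans hsub)
    exact ((hderiv x (hmem hx) s (mem_of_mem_nhds hsI)).hasDerivAt hsI).const_mul (k x)

/-- Weighted Cauchy–Schwarz inequality with weights `1/6 + 1/3 + 1/6 + 1/3 = 1`. -/
theorem sq_add_four_le (a b c e : ℝ) :
    (a + b + c + e) ^ 2 ≤ 6 * a ^ 2 + 3 * b ^ 2 + 6 * c ^ 2 + 3 * e ^ 2 := by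
  nlinarith [sq_nonneg (2 * a - b), sq_nonneg (a - c), sq_nonneg (2 * a - e),
    sq_nonneg (b - 2 * c), sq_nonneg (b - e), sq_nonneg (2 * c - e)]

end Helpers

theorem input_holding_error_growth_bound (ε lam q : ℝ)
    (hε : 0 < ε) (hlam : 0 < lam) (hq : 0 < q)
    -- `k`, twice continuously differentiable on `[0,1]` with `k'(0) = 0`
    (k k' k'' : ℝ → ℝ)
    (hk' : ∀ x ∈ Icc (0:ℝ) 1, HasDerivWithinAt k (k' x) (Icc 0 1) x)
    (hk'' : ∀ x ∈ Icc (0:ℝ) 1, HasDerivWithinAt k' (k'' x) (Icc 0 1) x)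
    (hk''c : ContinuousOn k'' (Icc 0 1))
    (hk'0 : k' 0 = 0)
    (I : Set ℝ) (p₁ : ℝ → ℝ) (hp₁ : ContinuousOn p₁ (Icc 0 1))
    (ξ : ℝ → ℝ) (hξ : ContinuousOn ξ I)
    (Ubar : ℝ)
    -- the kernel `L` of the inverse backstepping transformation
    (L : ℝ → ℝ → ℝ) (hL : ContinuousOn (fun p : ℝ × ℝ => L p.1 p.2) Tri)
    -- `u = û` is a classical solution of the observer system with held input `Ubar`
    (u ut ux uxx : ℝ → ℝ → ℝ)
    (hreg : ClassicalReg I u ut ux uxx)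
    (hpde : ∀ x ∈ Ioo (0:ℝ) 1, ∀ t ∈ I, ut x t = ε * uxx x t + lam * u x t + p₁ x * ξ t)
    (hbc0 : ∀ t ∈ I, ux 0 t = -(lam / (2 * ε)) * ξ t)
    (hbc1 : ∀ t ∈ I, ux 1 t + q * u 1 t = Ubar)
    -- `w = ŵ` with `û = ŵ + ∫₀ˣ L(x,y) ŵ(y,t) dy`
    (w : ℝ → ℝ → ℝ)
    (hwc : ContinuousOn (fun p : ℝ × ℝ => w p.1 p.2) (Icc 0 1 ×ˢ I))
    (huw : ∀ x ∈ Icc (0:ℝ) 1, ∀ t ∈ I, u x t = w x t + ∫ y in (0:ℝ)..x, L x y * w y t)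
    -- the input holding error
    (d : ℝ → ℝ) (hd : ∀ t, d t = Ubar - ∫ y in (0:ℝ)..1, k y * u y t)
    -- the constants
    (ρ₁ α₁ α₂ α₃ : ℝ)
    (hρ₁ : ρ₁ = 6 * ε ^ 2 * (k 1) ^ 2)
    (hα₁ : α₁ = 3 * (1 + Real.sqrt (∫ x in (0:ℝ)..1, ∫ y in (0:ℝ)..x, (L x y) ^ 2)) ^ 2 *
        (∫ y in (0:ℝ)..1, (ε * k'' y + ε * k 1 * k y + lam * k y) ^ 2)
      + 6 * (ε * q * k 1 + ε * k' 1) ^ 2 * ∫ y in (0:ℝ)..1, (L 1 y) ^ 2)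
    (hα₂ : α₂ = 6 * (ε * q * k 1 + ε * k' 1) ^ 2)
    (hα₃ : α₃ = 6 * (lam * k 0 / 2 + ∫ y in (0:ℝ)..1, k y * p₁ y) ^ 2) :
    ∀ t ∈ interior I, DifferentiableAt ℝ d t ∧
      (deriv d t) ^ 2 ≤ ρ₁ * (d t) ^ 2 + α₁ * (∫ x in (0:ℝ)..1, (w x t) ^ 2)
        + α₂ * (w 1 t) ^ 2 + α₃ * (ξ t) ^ 2 := by
  intro t ht
  have htI : t ∈ I := interior_subset ht
  have hslice : ∀ {g : ℝ → ℝ → ℝ},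
      ContinuousOn (fun p : ℝ × ℝ => g p.1 p.2) (Icc 0 1 ×ˢ I) →
      ContinuousOn (fun x => g x t) (Icc 0 1) := fun hg =>
    hg.comp (f := fun x => (x, t)) (by fun_prop) fun x hx => ⟨hx, htI⟩
  have hkc : ContinuousOn k (Icc 0 1) := fun x hx => (hk' x hx).continuousWithinAt
  have huc := hslice hreg.cont
  have huxxc := hslice hreg.cont_uxx
  have hwt := hslice hwc
  have hL1 : ContinuousOn (L 1) (Icc 0 1) :=
    hL.comp (f := fun y => ((1:ℝ), y)) (by fun_prop) fun y hy => ⟨hy.1, hy.2, le_rfl⟩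
  have hint : ∀ {g : ℝ → ℝ}, ContinuousOn g (Icc 0 1) →
      IntervalIntegrable g MeasureTheory.volume 0 1 := fun hg =>
    hg.intervalIntegrable_of_Icc zero_le_one
  have hderiv : HasDerivAt d (-∫ x in (0:ℝ)..1, k x * ut x t) t := by
    rw [funext hd]
    exact (hasDerivAt_integral_mul hkc hreg.cont hreg.cont_ut hreg.deriv_t ht).const_sub Ubar
  refine ⟨hderiv.differentiableAt, ?_⟩
  rw [hderiv.deriv]
  have hgreen := integral_mul_second_deriv hk' hk'' hk''c
    (fun x hx => hreg.deriv_x x hx t htI) (fun x hx => hreg.deriv_xx x hx t htI) huxxc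
  have hkut : ∫ x in (0:ℝ)..1, k x * ut x t
      = ε * (∫ x in (0:ℝ)..1, k x * uxx x t) + lam * (∫ x in (0:ℝ)..1, k x * u x t)
        + ξ t * ∫ x in (0:ℝ)..1, k x * p₁ x := by
    rw [← intervalIntegral.integral_const_mul, ← intervalIntegral.integral_const_mul,
      ← intervalIntegral.integral_const_mul, ← intervalIntegral.integral_add,
      ← intervalIntegral.integral_add]
    · refine intervalIntegral.integral_congr_Ioo_of_le zero_le_one fun x hx => ?_
      simp only [hpde x hx t htI]
      ring
    all_goals exact hint (by fun_prop)
  set g : ℝ → ℝ := fun y => ε * k'' y + ε * k 1 * k y + lam * k y with hg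
  have hgc : ContinuousOn g (Icc 0 1) := by fun_prop
  have hgu : ∫ x in (0:ℝ)..1, g x * u x t
      = ε * (∫ x in (0:ℝ)..1, k'' x * u x t)
        + (ε * k 1 + lam) * ∫ x in (0:ℝ)..1, k x * u x t := by
    rw [← intervalIntegral.integral_const_mul, ← intervalIntegral.integral_const_mul,
      ← intervalIntegral.integral_add]
    · refine intervalIntegral.integral_congr fun x _ => ?_
      simp only [hg]
      ring
    all_goals exact hint (by fun_prop)
  set b := ε * q * k 1 + ε * k' 1 with hb
  set D := ∫ x in (0:ℝ)..1, g x * u x t with hD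
  set P := lam * k 0 / 2 + ∫ y in (0:ℝ)..1, k y * p₁ y with hP
  set W := ∫ x in (0:ℝ)..1, (w x t) ^ 2 with hW
  have hdt : -∫ x in (0:ℝ)..1, k x * ut x t
      = -(ε * k 1 * d t) + b * u 1 t + -(P * ξ t) + -D := by
    have hux1 : ux 1 t = Ubar - q * u 1 t := by linarith [hbc1 t htI]
    rw [hkut, hgreen, hgu, hd t, hbc0 t htI, hux1, hk'0, hb, hP]
    field_simp
    ring
  have hDsq : D ^ 2 ≤ (∫ y in (0:ℝ)..1, g y ^ 2)
      * ((1 + √(∫ x in (0:ℝ)..1, ∫ y in (0:ℝ)..x, L x y ^ 2)) ^ 2 * W) := by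
    refine (sq_integral_mul_le zero_le_one hgc huc).trans (mul_le_mul_of_nonneg_left ?_
      (intervalIntegral.integral_nonneg zero_le_one fun y _ => sq_nonneg _))
    refine le_trans (le_of_eq ?_) (integral_sq_add_volterra_le hL hwt)
    refine intervalIntegral.integral_congr fun x hx => ?_
    rw [uIcc_of_le zero_le_one] at hx
    simp only [huw x hx t htI]
  have hu1 : u 1 t ^ 2 ≤ 2 * w 1 t ^ 2 + 2 * ((∫ y in (0:ℝ)..1, L 1 y ^ 2) * W) := by
    rw [huw 1 (right_mem_Icc.2 zero_le_one) t htI]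
    linarith [sq_integral_mul_le zero_le_one hL1 hwt, add_sq_le (a := w 1 t)
      (b := ∫ y in (0:ℝ)..1, L 1 y * w y t)]
  have hbu := mul_le_mul_of_nonneg_left hu1 (sq_nonneg b)
  rw [hdt, hρ₁, hα₁, hα₂, hα₃]
  refine (sq_add_four_le _ _ _ _).trans ?_
  linear_combination 3 * hDsq + 3 * hbu
end

section
/- Let σ ∈ (0,1) and η, ρ, ρ₁ > 0. Let I be an open interval, let d, m : I → ℝ be differentiable, and let S : I → ℝ satisfy S(t) ≥ 0 for all t ∈ I. Suppose that for all t ∈ I: m(t) < 0, d(t)² + (1−σ)·m(t) ≥ 0, (d′(t))² ≤ ρ₁·d(t)² + S(t), and m′(t) = −η·m(t) + ρ·d(t)² − S(t)/(1−σ). Define ψ(t) = (d(t)² + (1−σ)·m(t))/(−σ·m(t)). Then ψ is differentiable on I and ψ′(t) ≤ a₁·ψ(t)² + a₂·ψ(t) + a₃ for all t ∈ I, where a₁ = σρ, a₂ = 1 + ρ₁ + 2(1−σ)ρ + η, and a₃ = (1 + ρ₁ + (1−σ)ρ + η)·(1−σ)/σ. -/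
open Real Set

theorem normalized_trigger_riccati_bound (σ η ρ ρ₁ : ℝ)
    (hσ : σ ∈ Ioo (0:ℝ) 1) (hη : 0 < η) (hρ : 0 < ρ) (hρ₁ : 0 < ρ₁)
    (a b : ℝ)
    (d m d' m' S : ℝ → ℝ)
    (hS : ∀ t ∈ Ioo a b, 0 ≤ S t)
    (hd : ∀ t ∈ Ioo a b, HasDerivAt d (d' t) t)
    (hm : ∀ t ∈ Ioo a b, HasDerivAt m (m' t) t)
    (hmneg : ∀ t ∈ Ioo a b, m t < 0)
    (hnonneg : ∀ t ∈ Ioo a b, 0 ≤ (d t) ^ 2 + (1 - σ) * m t)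
    (hd' : ∀ t ∈ Ioo a b, (d' t) ^ 2 ≤ ρ₁ * (d t) ^ 2 + S t)
    (hm' : ∀ t ∈ Ioo a b, m' t = -η * m t + ρ * (d t) ^ 2 - S t / (1 - σ))
    (ψ : ℝ → ℝ)
    (hψ : ∀ t, ψ t = ((d t) ^ 2 + (1 - σ) * m t) / (-σ * m t)) :
    ∀ t ∈ Ioo a b, DifferentiableAt ℝ ψ t ∧
      deriv ψ t ≤ σ * ρ * (ψ t) ^ 2 + (1 + ρ₁ + 2 * (1 - σ) * ρ + η) * ψ t
        + (1 + ρ₁ + (1 - σ) * ρ + η) * (1 - σ) / σ := by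
  obtain ⟨hσ0, hσ1⟩ := hσ
  intro t ht
  have hn : 0 < -m t := neg_pos.mpr (hmneg t ht)
  have hn0 : m t ≠ 0 := (hmneg t ht).ne
  have h1σ : 0 < 1 - σ := sub_pos.mpr hσ1
  have h1σ0 : 1 - σ ≠ 0 := h1σ.ne'
  have hσ0' : σ ≠ 0 := hσ0.ne'
  have hden : -σ * m t ≠ 0 := mul_ne_zero (neg_ne_zero.mpr hσ0') hn0
  have hderiv := (((hd t ht).pow 2).add ((hm t ht).const_mul (1 - σ))).div
    ((hm t ht).const_mul (-σ)) hden
  have hψd : HasDerivAt ψ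
      (2 * d t * d' t / (σ * -m t) + d t ^ 2 * m' t / (σ * (-m t) ^ 2)) t := by
    rw [show ψ = fun t => ((d t) ^ 2 + (1 - σ) * m t) / (-σ * m t) from funext hψ]
    refine hderiv.congr_deriv ?_
    simp only [Pi.add_apply, Pi.pow_apply]
    field_simp
    ring
  refine ⟨hψd.differentiableAt, ?_⟩
  rw [hψd.deriv]
  have hYoung : 2 * d t * d' t ≤ (1 + ρ₁) * d t ^ 2 + S t := by
    nlinarith [sq_nonneg (d t - d' t), hd' t ht]
  have hgap : 0 ≤ S t * (d t ^ 2 + (1 - σ) * m t) / (σ * (1 - σ) * (-m t) ^ 2) :=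
    div_nonneg (mul_nonneg (hS t ht) (hnonneg t ht)) (by positivity)
  calc
    2 * d t * d' t / (σ * -m t) + d t ^ 2 * m' t / (σ * (-m t) ^ 2)
        ≤ ((1 + ρ₁) * d t ^ 2 + S t) / (σ * -m t) + d t ^ 2 * m' t / (σ * (-m t) ^ 2) := by
      gcongr
    _ = σ * ρ * (ψ t) ^ 2 + (1 + ρ₁ + 2 * (1 - σ) * ρ + η) * ψ t
          + (1 + ρ₁ + (1 - σ) * ρ + η) * (1 - σ) / σ
          - S t * (d t ^ 2 + (1 - σ) * m t) / (σ * (1 - σ) * (-m t) ^ 2) := by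
      rw [hψ t, hm' t ht]
      field_simp
      ring
    _ ≤ _ := sub_le_self _ hgap
end

section
/- Let a₁, a₂, a₃ > 0 and let ψ : [t₀, t₁] → ℝ be differentiable with ψ′(t) ≤ a₁·ψ(t)² + a₂·ψ(t) + a₃ for all t ∈ [t₀, t₁]. If ψ(t₀) = 0 and ψ(t₁) = 1, then t₁ − t₀ ≥ ∫₀¹ 1/(a₁ s² + a₂ s + a₃) ds. -/
open Real Set

/-- A solution of the autonomous differential inequality `ψ' ≤ F ψ`, with `F` continuous and
positive, needs at least time `∫ 1 / F` to travel between two values. -/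
theorem integral_one_div_le_sub_of_hasDerivWithinAt_le {F ψ ψ' : ℝ → ℝ} {t₀ t₁ : ℝ}
    (hF : Continuous F) (hpos : ∀ x, 0 < F x) (ht : t₀ ≤ t₁)
    (hψ : ∀ t ∈ Icc t₀ t₁, HasDerivWithinAt ψ (ψ' t) (Icc t₀ t₁) t)
    (hle : ∀ t ∈ Icc t₀ t₁, ψ' t ≤ F (ψ t)) :
    ∫ s in ψ t₀..ψ t₁, 1 / F s ≤ t₁ - t₀ := by
  have hc : Continuous fun s => 1 / F s := continuous_const.div hF fun x => (hpos x).ne'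
  have hG (t : ℝ) (h : t ∈ Icc t₀ t₁) :
      HasDerivWithinAt (fun t => t - ∫ s in ψ t₀..ψ t, 1 / F s)
        (1 - 1 / F (ψ t) * ψ' t) (Icc t₀ t₁) t :=
    (hasDerivWithinAt_id t _).sub
      ((hc.integral_hasStrictDerivAt (ψ t₀) (ψ t)).hasDerivAt.comp_hasDerivWithinAt t (hψ t h))
  have hmono := monotoneOn_of_hasDerivWithinAt_nonneg (convex_Icc t₀ t₁)
    (fun t h => (hG t h).continuousWithinAt)
    (fun t h => (hG t (interior_subset h)).mono interior_subset)
    (fun t h => by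
      have := hle t (interior_subset h)
      rw [one_div_mul_eq_div, sub_nonneg, div_le_one (hpos _)]
      exact this)
  have h := hmono (left_mem_Icc.2 ht) (right_mem_Icc.2 ht) ht
  simp only [intervalIntegral.integral_same, sub_zero] at h
  linarith

theorem riccati_comparison_travel_time (a₁ a₂ a₃ : ℝ)
    (ha₁ : 0 < a₁) (ha₂ : 0 < a₂) (ha₃ : 0 < a₃)
    (t₀ t₁ : ℝ) (ht : t₀ ≤ t₁)
    (ψ ψ' : ℝ → ℝ)
    (hψ : ∀ t ∈ Icc t₀ t₁, HasDerivWithinAt ψ (ψ' t) (Icc t₀ t₁) t)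
    (hineq : ∀ t ∈ Icc t₀ t₁, ψ' t ≤ a₁ * (ψ t) ^ 2 + a₂ * ψ t + a₃)
    (h0 : ψ t₀ = 0) (h1 : ψ t₁ = 1) :
    (∫ s in (0:ℝ)..1, 1 / (a₁ * s ^ 2 + a₂ * s + a₃)) ≤ t₁ - t₀ := by
  -- `ψ` may become negative, where the quadratic can vanish; `|s|` keeps the bound positive.
  have h := integral_one_div_le_sub_of_hasDerivWithinAt_le
    (F := fun s => a₁ * s ^ 2 + a₂ * |s| + a₃) (by fun_prop) (fun x => by positivity) ht hψ
    (fun t h => (hineq t h).trans (by gcongr; exact le_abs_self _))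
  rw [h0, h1] at h
  refine le_of_eq_of_le (intervalIntegral.integral_congr fun s hs => ?_) h
  rw [uIcc_of_le zero_le_one] at hs
  simp only [abs_of_nonneg hs.1]
end

section
/- Let σ ∈ (0,1) and η, ρ, ρ₁ > 0, and let t_j < t_{j+1} be real numbers. Let d, m : [t_j, t_{j+1}] → ℝ be differentiable and S : [t_j, t_{j+1}] → ℝ with S(t) ≥ 0 for all t. Suppose: m(t) < 0 for all t ∈ [t_j, t_{j+1}]; d(t_j) = 0; d(t)² ≤ −m(t) for all t ∈ [t_j, t_{j+1}]; d(t_{j+1})² = −m(t_{j+1}); (d′(t))² ≤ ρ₁·d(t)² + S(t) for all t; and m′(t) = −η·m(t) + ρ·d(t)² − S(t)/(1−σ) for all t. Then t_{j+1} − t_j ≥ τ, where τ = ∫₀¹ 1/(a₁ s² + a₂ s + a₃) ds with a₁ = σρ, a₂ = 1 + ρ₁ + 2(1−σ)ρ + η, and a₃ = (1 + ρ₁ + (1−σ)ρ + η)·(1−σ)/σ. -/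
open Real Set

/-- Growth bound for the ratio `x ^ 2 / M` once it exceeds the level `1 - σ`; here `v` and `-n` are
the derivatives of `x` and `M`. -/
lemma ratio_deriv_le {σ η ρ ρ₁ x v M n S : ℝ} (hσ : σ < 1) (hM : 0 < M) (hS : 0 ≤ S)
    (hv : v ^ 2 ≤ ρ₁ * x ^ 2 + S) (hn : n = η * M + ρ * x ^ 2 - S / (1 - σ))
    (hx : 1 - σ < x ^ 2 / M) :
    (2 * x * v * M - x ^ 2 * -n) / M ^ 2
      ≤ (1 + ρ₁ + η) * (x ^ 2 / M) + ρ * (x ^ 2 / M) ^ 2 := by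
  have hσ' : 0 < 1 - σ := by linarith
  rw [lt_div_iff₀ hM] at hx
  obtain ⟨K, hK⟩ : ∃ K, K = S / (1 - σ) := ⟨_, rfl⟩
  have hSK : S = K * (1 - σ) := by rw [hK]; field_simp
  have hK0 : 0 ≤ K := by rw [hK]; positivity
  have hrhs : (1 + ρ₁ + η) * (x ^ 2 / M) + ρ * (x ^ 2 / M) ^ 2
      = ((1 + ρ₁ + η) * x ^ 2 * M + ρ * (x ^ 2) ^ 2) / M ^ 2 := by
    field_simp
  rw [hrhs]
  gcongr
  rw [hn, ← hK]
  have h1 : 2 * x * v * M ≤ ((1 + ρ₁) * x ^ 2 + K * (1 - σ)) * M := by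
    apply mul_le_mul_of_nonneg_right _ hM.le
    linarith [sq_nonneg (x - v)]
  linarith [mul_nonneg hK0 (sub_nonneg.2 hx.le)]

/-- If `ψ` reaches `1` from a nonpositive value and satisfies `ψ' ≤ q ψ` wherever `ψ > 0`, then this
takes at least the time `∫ s in 0..1, 1 / q s`. -/
lemma integral_one_div_le_of_deriv_le {q ψ ψ' : ℝ → ℝ} {a b : ℝ} (hab : a ≤ b)
    (hq : Continuous q) (hq0 : ∀ s, 0 ≤ s → 0 < q s)
    (hψ : ∀ t ∈ Icc a b, HasDerivWithinAt ψ (ψ' t) (Icc a b) t)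
    (ha : ψ a ≤ 0) (hb : ψ b = 1)
    (hle : ∀ t ∈ Icc a b, 0 < ψ t → ψ' t ≤ q (ψ t)) :
    ∫ s in (0:ℝ)..1, 1 / q s ≤ b - a := by
  have hψc : ContinuousOn ψ (Icc a b) := fun t ht => (hψ t ht).continuousWithinAt
  obtain ⟨T, ⟨hT, hTψ⟩, hTmax⟩ : ∃ T, IsGreatest (Icc a b ∩ ψ ⁻¹' Iic 0) T :=
    (isCompact_Icc.of_isClosed_subset (hψc.preimage_isClosed_of_isClosed isClosed_Icc isClosed_Iic)
      inter_subset_left).exists_isGreatest ⟨a, left_mem_Icc.2 hab, ha⟩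
  have hpos : ∀ t ∈ Ioo T b, 0 < ψ t := fun t ht => by
    by_contra! h
    exact absurd (hTmax ⟨⟨hT.1.trans ht.1.le, ht.2.le⟩, h⟩) (not_le.2 ht.1)
  -- extending `1 / q` by a constant to the left of `0` gives a globally continuous integrand
  set f : ℝ → ℝ := fun s => 1 / q (max s 0) with hf
  have hfc : Continuous f :=
    continuous_const.div (by fun_prop) fun s => (hq0 _ (le_max_right s 0)).ne'
  have hf0 : ∀ s, 0 ≤ f s := fun s => (one_div_pos.2 (hq0 _ (le_max_right s 0))).le
  set F : ℝ → ℝ := fun x => ∫ s in (0:ℝ)..x, f s with hF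
  have hFd : ∀ x, HasDerivAt F (f x) x := fun x => hfc.integral_hasStrictDerivAt 0 x |>.hasDerivAt
  have hFc : Continuous F := continuous_iff_continuousAt.2 fun x => (hFd x).continuousAt
  have hder : ∀ t ∈ Ioo T b, HasDerivAt (F ∘ ψ) (f (ψ t) * ψ' t) t := fun t ht =>
    (hFd (ψ t)).comp t ((hψ t ⟨hT.1.trans ht.1.le, ht.2.le⟩).hasDerivAt
      (Icc_mem_nhds (hT.1.trans_lt ht.1) ht.2))
  have key : (F ∘ ψ) b - (F ∘ ψ) T ≤ 1 * (b - T) := by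
    refine (convex_Icc T b).image_sub_le_mul_sub_of_deriv_le
      (hFc.comp_continuousOn (hψc.mono (Icc_subset_Icc_left hT.1))) ?_ ?_ T
      (left_mem_Icc.2 hT.2) b (right_mem_Icc.2 hT.2) hT.2
    · rw [interior_Icc]
      exact fun t ht => (hder t ht).differentiableAt.differentiableWithinAt
    · rw [interior_Icc]
      intro t ht
      have hp := hpos t ht
      rw [(hder t ht).deriv, hf]
      simp only [max_eq_left hp.le]
      rw [one_div_mul_eq_div, div_le_one (hq0 _ hp.le)]
      exact hle t ⟨hT.1.trans ht.1.le, ht.2.le⟩ hp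
  have hFT : F (ψ T) ≤ 0 := by
    rw [hF]
    simp only
    rw [intervalIntegral.integral_symm]
    exact neg_nonpos.2 (intervalIntegral.integral_nonneg hTψ fun s _ => hf0 s)
  have hF1 : F (ψ b) = ∫ s in (0:ℝ)..1, 1 / q s := by
    rw [hb]
    refine intervalIntegral.integral_congr fun s hs => ?_
    rw [uIcc_of_le zero_le_one] at hs
    simp only [hf, max_eq_left hs.1]
  simp only [Function.comp_apply] at key
  linarith [hT.1]

theorem minimal_dwell_time (σ η ρ ρ₁ : ℝ)
    (hσ : σ ∈ Ioo (0:ℝ) 1) (hη : 0 < η) (hρ : 0 < ρ) (hρ₁ : 0 < ρ₁)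
    (t₀ t₁ : ℝ) (ht : t₀ < t₁)
    (d m d' m' S : ℝ → ℝ)
    (hS : ∀ t ∈ Icc t₀ t₁, 0 ≤ S t)
    (hd : ∀ t ∈ Icc t₀ t₁, HasDerivWithinAt d (d' t) (Icc t₀ t₁) t)
    (hm : ∀ t ∈ Icc t₀ t₁, HasDerivWithinAt m (m' t) (Icc t₀ t₁) t)
    (hmneg : ∀ t ∈ Icc t₀ t₁, m t < 0)
    (hd0 : d t₀ = 0)
    (htrig : ∀ t ∈ Icc t₀ t₁, (d t) ^ 2 ≤ -m t)
    (hev : (d t₁) ^ 2 = -m t₁)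
    (hd' : ∀ t ∈ Icc t₀ t₁, (d' t) ^ 2 ≤ ρ₁ * (d t) ^ 2 + S t)
    (hm' : ∀ t ∈ Icc t₀ t₁, m' t = -η * m t + ρ * (d t) ^ 2 - S t / (1 - σ)) :
    (∫ s in (0:ℝ)..1, 1 / (σ * ρ * s ^ 2 + (1 + ρ₁ + 2 * (1 - σ) * ρ + η) * s
        + (1 + ρ₁ + (1 - σ) * ρ + η) * (1 - σ) / σ)) ≤ t₁ - t₀ := by
  obtain ⟨hσ0, hσ1⟩ := hσ
  have hσ' : 0 < 1 - σ := by linarith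
  have hq (s : ℝ) : σ * ρ * s ^ 2 + (1 + ρ₁ + 2 * (1 - σ) * ρ + η) * s
        + (1 + ρ₁ + (1 - σ) * ρ + η) * (1 - σ) / σ
      = ((1 + ρ₁ + η) * (1 - σ + σ * s) + ρ * (1 - σ + σ * s) ^ 2) / σ := by
    field_simp
    ring
  refine integral_one_div_le_of_deriv_le
    (ψ := fun t => (d t ^ 2 / -m t - (1 - σ)) / σ)
    (ψ' := fun t => (2 * d t * d' t * -m t - d t ^ 2 * -m' t) / (-m t) ^ 2 / σ)
    ht.le (by fun_prop) (fun s hs => by positivity) (fun t ht => ?_) ?_ ?_ (fun t ht hpos => ?_)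
  · have h := ((((hd t ht).pow 2).div (hm t ht).neg
      (neg_ne_zero.2 (hmneg t ht).ne)).sub_const (1 - σ)).div_const σ
    exact h.congr_deriv (by simp)
  · simp only [hd0]
    apply div_nonpos_of_nonpos_of_nonneg _ hσ0.le
    simp [hσ1.le]
  · have h := hmneg t₁ (right_mem_Icc.2 ht.le)
    simp only [hev]
    rw [div_self (by linarith)]
    field_simp
    ring
  · have hM : 0 < -m t := neg_pos.2 (hmneg t ht)
    have hx : 1 - σ < d t ^ 2 / -m t := sub_pos.1 ((div_pos_iff_of_pos_right hσ0).1 hpos)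
    rw [hq, mul_div_cancel₀ _ hσ0.ne', add_sub_cancel]
    gcongr
    exact ratio_deriv_le hσ1 hM (hS t ht) (hd' t ht) (by rw [hm' t ht]; ring) hx
end

section
/- Let ε > 0, λ, q, r, A, B ∈ ℝ, let g : [0,1] → ℝ be continuous, let I be an open interval, and let d : I → ℝ be continuous. Let w̃ be a classical solution on [0,1]×I of w̃_t = ε w̃_xx with w̃_x(0,t) = 0 and w̃_x(1,t) = −q·w̃(1,t), and let ŵ be a classical solution on [0,1]×I of ŵ_t(x,t) = ε ŵ_xx(x,t) + g(x)·w̃(0,t) with ŵ_x(0,t) = −(λ/(2ε))·w̃(0,t) and ŵ_x(1,t) = −r·ŵ(1,t) + d(t). Define V₀(t) = (A/2)·∫₀¹ w̃(x,t)² dx + (B/2)·∫₀¹ ŵ(x,t)² dx. Then V₀ is differentiable on I and V₀′(t) = −A·ε·q·w̃(1,t)² − A·ε·∫₀¹ w̃_x(x,t)² dx − r·ε·B·ŵ(1,t)² + ε·B·d(t)·ŵ(1,t) + (λ·B/2)·ŵ(0,t)·w̃(0,t) − ε·B·∫₀¹ ŵ_x(x,t)² dx + B·w̃(0,t)·∫₀¹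 g(x)·ŵ(x,t) dx. -/
open Real Set

namespace ClassicalReg

variable {I : Set ℝ} {u ut ux uxx : ℝ → ℝ → ℝ}

theorem continuousOn_slice {f : ℝ → ℝ → ℝ}
    (hf : ContinuousOn (fun p : ℝ × ℝ => f p.1 p.2) (Icc 0 1 ×ˢ I)) {t : ℝ} (ht : t ∈ I) :
    ContinuousOn (fun x => f x t) (Icc 0 1) :=
  hf.comp (f := fun x : ℝ => (x, t)) (by fun_prop) fun _ hx => ⟨hx, ht⟩

/-- Differentiation under the integral sign for the squared `L²` norm. -/
theorem hasDerivAt_integral_sq (h : ClassicalReg I u ut ux uxx) (hI : IsOpen I) {t : ℝ}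
    (ht : t ∈ I) :
    HasDerivAt (fun s => ∫ x in (0:ℝ)..1, u x s ^ 2) (∫ x in (0:ℝ)..1, 2 * u x t * ut x t) t := by
  obtain ⟨δ, hδ, hball⟩ := Metric.nhds_basis_closedBall.mem_iff.1 (hI.mem_nhds ht)
  have hF' : ContinuousOn (fun p : ℝ × ℝ => 2 * u p.1 p.2 * ut p.1 p.2) (Icc 0 1 ×ˢ I) :=
    (continuousOn_const.mul h.cont).mul h.cont_ut
  obtain ⟨C, hC⟩ := (isCompact_Icc.prod (isCompact_closedBall t δ)).exists_bound_of_continuousOn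
    (hF'.mono (prod_mono_right hball))
  have hsub : uIoc (0:ℝ) 1 ⊆ Icc 0 1 := by
    rw [uIoc_of_le zero_le_one]; exact Ioc_subset_Icc_self
  have hmeas {f : ℝ → ℝ} (hf : ContinuousOn f (Icc 0 1)) : MeasureTheory.AEStronglyMeasurable f
      (MeasureTheory.volume.restrict (uIoc (0:ℝ) 1)) :=
    (hf.mono hsub).aestronglyMeasurable measurableSet_uIoc
  have hsq {s : ℝ} (hs : s ∈ I) : ContinuousOn (fun x => u x s ^ 2) (Icc 0 1) :=
    (continuousOn_slice h.cont hs).pow 2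
  refine (intervalIntegral.hasDerivAt_integral_of_dominated_loc_of_deriv_le
    (F := fun s x => u x s ^ 2) (F' := fun s x => 2 * u x s * ut x s) (bound := fun _ => C)
    (Metric.closedBall_mem_nhds t hδ) ?_ ?_ ?_ ?_ intervalIntegrable_const ?_).2
  · filter_upwards [hI.mem_nhds ht] with s hs using hmeas (hsq hs)
  · exact (hsq ht).intervalIntegrable_of_Icc zero_le_one
  · exact hmeas (continuousOn_slice (f := fun x s => 2 * u x s * ut x s) hF' ht)
  · exact .of_forall fun x hx s hs => hC (x, s) ⟨hsub hx, hs⟩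
  · refine .of_forall fun x hx s hs => ?_
    simpa using ((h.deriv_t x (hsub hx) s (hball hs)).hasDerivAt (hI.mem_nhds (hball hs))).fun_pow 2

/-- Energy identity for a classical solution of `uₜ = ε uₓₓ + f`. -/
theorem hasDerivAt_energy (h : ClassicalReg I u ut ux uxx) (hI : IsOpen I) {t : ℝ} (ht : t ∈ I)
    {ε : ℝ} {f : ℝ → ℝ} (hf : ContinuousOn f (Icc 0 1))
    (hpde : ∀ x ∈ Ioo (0:ℝ) 1, ut x t = ε * uxx x t + f x) :
    HasDerivAt (fun s => ∫ x in (0:ℝ)..1, u x s ^ 2)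
      (2 * (ε * (u 1 t * ux 1 t - u 0 t * ux 0 t - ∫ x in (0:ℝ)..1, ux x t ^ 2)
        + ∫ x in (0:ℝ)..1, f x * u x t)) t := by
  have hu := continuousOn_slice h.cont ht
  have hux := continuousOn_slice h.cont_ux ht
  have huxx := continuousOn_slice h.cont_uxx ht
  have hparts := intervalIntegral.integral_mul_deriv_eq_deriv_mul_of_hasDerivWithinAt
    (a := 0) (b := 1) (u := fun x => u x t) (v := fun x => ux x t)
    (u' := fun x => ux x t) (v' := fun x => uxx x t)
    (by rw [uIcc_of_le zero_le_one]; exact fun x hx => h.deriv_x x hx t ht)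
    (by rw [uIcc_of_le zero_le_one]; exact fun x hx => h.deriv_xx x hx t ht)
    (hux.intervalIntegrable_of_Icc zero_le_one) (huxx.intervalIntegrable_of_Icc zero_le_one)
  have hsplit : ∫ x in (0:ℝ)..1, 2 * u x t * ut x t
      = ∫ x in (0:ℝ)..1, (2 * ε * (u x t * uxx x t) + 2 * (f x * u x t)) := by
    refine intervalIntegral.integral_congr_Ioo_of_le zero_le_one fun x hx => ?_
    simp only [hpde x hx]
    ring
  refine (h.hasDerivAt_integral_sq hI ht).congr_deriv ?_
  rw [hsplit, intervalIntegral.integral_add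
    (((hu.fun_mul huxx).intervalIntegrable_of_Icc zero_le_one).const_mul _)
    (((hf.fun_mul hu).intervalIntegrable_of_Icc zero_le_one).const_mul _),
    intervalIntegral.integral_const_mul, intervalIntegral.integral_const_mul, hparts]
  simp only [sq]
  ring

end ClassicalReg

theorem lyapunov_quadratic_part_derivative (ε lam q r A B : ℝ) (hε : 0 < ε)
    (g : ℝ → ℝ) (hg : ContinuousOn g (Icc 0 1))
    (a b : ℝ)  -- the open interval `I = (a,b)`
    (dd : ℝ → ℝ) (hdd : ContinuousOn dd (Ioo a b))
    -- `v = w̃` is a classical solution of the observer-error target system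
    (v vt vx vxx : ℝ → ℝ → ℝ)
    (hvreg : ClassicalReg (Ioo a b) v vt vx vxx)
    (hvpde : ∀ x ∈ Ioo (0:ℝ) 1, ∀ t ∈ Ioo a b, vt x t = ε * vxx x t)
    (hvbc0 : ∀ t ∈ Ioo a b, vx 0 t = 0)
    (hvbc1 : ∀ t ∈ Ioo a b, vx 1 t = -q * v 1 t)
    -- `w = ŵ` is a classical solution of the observer target system with holding error `dd`
    (w wt wx wxx : ℝ → ℝ → ℝ)
    (hwreg : ClassicalReg (Ioo a b) w wt wx wxx)
    (hwpde : ∀ x ∈ Ioo (0:ℝ) 1, ∀ t ∈ Ioo a b, wt x t = ε * wxx x t + g x * v 0 t)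
    (hwbc0 : ∀ t ∈ Ioo a b, wx 0 t = -(lam / (2 * ε)) * v 0 t)
    (hwbc1 : ∀ t ∈ Ioo a b, wx 1 t = -r * w 1 t + dd t)
    -- the quadratic part of the Lyapunov function
    (V₀ : ℝ → ℝ)
    (hV₀ : ∀ t, V₀ t = A / 2 * (∫ x in (0:ℝ)..1, (v x t) ^ 2)
      + B / 2 * ∫ x in (0:ℝ)..1, (w x t) ^ 2) :
    ∀ t ∈ Ioo a b, HasDerivAt V₀
      (-A * ε * q * (v 1 t) ^ 2 - A * ε * (∫ x in (0:ℝ)..1, (vx x t) ^ 2)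
        - r * ε * B * (w 1 t) ^ 2 + ε * B * dd t * w 1 t
        + lam * B / 2 * w 0 t * v 0 t
        - ε * B * (∫ x in (0:ℝ)..1, (wx x t) ^ 2)
        + B * v 0 t * ∫ x in (0:ℝ)..1, g x * w x t) t := by
  intro t ht
  have hv := hvreg.hasDerivAt_energy isOpen_Ioo ht (ε := ε) (f := fun _ => 0) continuousOn_const
    fun x hx => by simpa using hvpde x hx t ht
  have hw := hwreg.hasDerivAt_energy isOpen_Ioo ht (ε := ε) (f := fun x => g x * v 0 t)
    (hg.mul continuousOn_const) fun x hx => hwpde x hx t ht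
  have hsource : ∫ x in (0:ℝ)..1, g x * v 0 t * w x t
      = v 0 t * ∫ x in (0:ℝ)..1, g x * w x t := by
    rw [← intervalIntegral.integral_const_mul]
    congr 1 with x
    ring
  rw [funext hV₀]
  refine ((hv.const_mul (A / 2)).fun_add (hw.const_mul (B / 2))).congr_deriv ?_
  rw [hsource, hvbc0 t ht, hvbc1 t ht, hwbc0 t ht, hwbc1 t ht]
  simp only [zero_mul, intervalIntegral.integral_zero]
  field_simp
  ring
end

section
/- Let ε, λ > 0 and q > (λ+ε)/(2ε), and set r = q − λ/(2ε). Let g : [0,1] → ℝ be continuous with ‖g‖² = ∫₀¹ g(x)² dx. Let η, β₁, β₂, β₃, κ₁, κ₂, κ₃ > 0 and B > 0 satisfy B·(ε·min{r − 1/2, 1/2} − ε/(2κ₁) − 5λ/(8κ₂) − ‖g‖²/κ₃) − 2β₁ − β₂ > 0, let A > 0 satisfy A·ε·min{q − 1/2, 1/2} − (5λκ₂B)/8 − (5κ₃B)/4 − (5β₃)/2 > 0, and set ρ = ε·κ₁·B/2. Define b₁ = Aε/4 − 5λκ₂B/16 − 5κ₃B/8 − 5β₃/4, b₂ = εB/4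 − 5λB/(16κ₂) − ‖g‖²B/(2κ₃) − β₁, and ϱ = min{b₁, b₂, η}/max{A/2, B/2, 1}. Then for all continuously differentiable v, w : [0,1] → ℝ and all d ∈ ℝ, m ≤ 0: −Aεq·v(1)² − Aε·∫₀¹ v′(x)² dx − rεB·w(1)² + εB·d·w(1) + (λB/2)·w(0)·v(0) − εB·∫₀¹ w′(x)² dx + B·v(0)·∫₀¹ g(x)·w(x) dx + η·m − ρ·d² + β₁·∫₀¹ w(x)² dx + β₂·w(1)² + β₃·v(0)² ≤ −ϱ·((A/2)·∫₀¹ v(x)² dx + (B/2)·∫₀¹ w(x)² dx − m). -/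
open Real Set

theorem sq_intervalIntegral_mul_le {f g : ℝ → ℝ} {a b : ℝ} (hab : a ≤ b)
    (hf : ContinuousOn f (Icc a b)) (hg : ContinuousOn g (Icc a b)) :
    (∫ x in a..b, f x * g x) ^ 2 ≤ (∫ x in a..b, f x ^ 2) * ∫ x in a..b, g x ^ 2 := by
  have hff : IntervalIntegrable (fun x => f x ^ 2) MeasureTheory.volume a b :=
    (hf.pow 2).intervalIntegrable_of_Icc hab
  have hfg : IntervalIntegrable (fun x => f x * g x) MeasureTheory.volume a b :=
    (hf.mul hg).intervalIntegrable_of_Icc hab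
  have hgg : IntervalIntegrable (fun x => g x ^ 2) MeasureTheory.volume a b :=
    (hg.pow 2).intervalIntegrable_of_Icc hab
  have hquad : ∀ t : ℝ, 0 ≤ (∫ x in a..b, f x ^ 2) * (t * t)
      + (2 * ∫ x in a..b, f x * g x) * t + ∫ x in a..b, g x ^ 2 := by
    intro t
    have h : ∫ x in a..b, (t * f x + g x) ^ 2 = (∫ x in a..b, f x ^ 2) * (t * t)
        + (2 * ∫ x in a..b, f x * g x) * t + ∫ x in a..b, g x ^ 2 := by
      rw [show (fun x => (t * f x + g x) ^ 2)
          = fun x => t * t * f x ^ 2 + 2 * t * (f x * g x) + g x ^ 2 by ext; ring,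
        intervalIntegral.integral_add ((hff.const_mul _).add (hfg.const_mul _)) hgg,
        intervalIntegral.integral_add (hff.const_mul _) (hfg.const_mul _),
        intervalIntegral.integral_const_mul, intervalIntegral.integral_const_mul]
      ring
    rw [← h]
    exact intervalIntegral.integral_nonneg hab fun x _ => sq_nonneg _
  have h := discrim_le_zero hquad
  rw [discrim] at h
  linarith

theorem sq_zero_le_of_hasDerivWithinAt {u u' : ℝ → ℝ}
    (hu : ∀ x ∈ Icc (0 : ℝ) 1, HasDerivWithinAt u (u' x) (Icc 0 1) x)
    (hu' : ContinuousOn u' (Icc 0 1)) :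
    u 0 ^ 2 ≤ 2 * u 1 ^ 2 + 2 * ∫ x in (0 : ℝ)..1, u' x ^ 2 := by
  have hftc : ∫ x in (0 : ℝ)..1, u' x = u 1 - u 0 :=
    intervalIntegral.integral_eq_sub_of_hasDerivAt_of_le zero_le_one
      (fun x hx => (hu x hx).continuousWithinAt)
      (fun x hx => (hu x (Ioo_subset_Icc_self hx)).hasDerivAt (Icc_mem_nhds hx.1 hx.2))
      (hu'.intervalIntegrable_of_Icc zero_le_one)
  have hcs := sq_intervalIntegral_mul_le zero_le_one
    (continuousOn_const (c := (1 : ℝ)) (s := Icc (0 : ℝ) 1)) hu'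
  simp only [one_mul, hftc, one_pow, intervalIntegral.integral_const, sub_zero, smul_eq_mul] at hcs
  nlinarith [sq_nonneg (2 * u 1 - u 0)]

/-- Poincaré's inequality on the unit interval with the boundary term at `1`. -/
theorem integral_sq_le_of_hasDerivWithinAt {u u' : ℝ → ℝ}
    (hu : ∀ x ∈ Icc (0 : ℝ) 1, HasDerivWithinAt u (u' x) (Icc 0 1) x)
    (hu' : ContinuousOn u' (Icc 0 1)) :
    ∫ x in (0 : ℝ)..1, u x ^ 2 ≤ 2 * u 1 ^ 2 + 4 * ∫ x in (0 : ℝ)..1, u' x ^ 2 := by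
  have huc : ContinuousOn u (Icc 0 1) := fun x hx => (hu x hx).continuousWithinAt
  have hi : IntervalIntegrable (fun x => u x ^ 2) MeasureTheory.volume 0 1 :=
    (huc.pow 2).intervalIntegrable_of_Icc zero_le_one
  have hi' : IntervalIntegrable (fun x => u' x ^ 2) MeasureTheory.volume 0 1 :=
    (hu'.pow 2).intervalIntegrable_of_Icc zero_le_one
  have hD : IntervalIntegrable (fun x => u x ^ 2 + x * (2 * u x * u' x))
      MeasureTheory.volume 0 1 :=
    ContinuousOn.intervalIntegrable_of_Icc zero_le_one (by fun_prop)
  have hftc : ∫ x in (0 : ℝ)..1, (u x ^ 2 + x * (2 * u x * u' x))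
      = 1 * u 1 ^ 2 - 0 * u 0 ^ 2 :=
    intervalIntegral.integral_eq_sub_of_hasDerivAt_of_le (f := fun x => x * u x ^ 2) zero_le_one
      (by fun_prop)
      (fun x hx => by
        have h := (hu x (Ioo_subset_Icc_self hx)).hasDerivAt (Icc_mem_nhds hx.1 hx.2)
        exact ((hasDerivAt_id' x).fun_mul (h.fun_pow 2)).congr_deriv (by simp)) hD
  have hmono : ∫ x in (0 : ℝ)..1, u x ^ 2 ≤ ∫ x in (0 : ℝ)..1,
      ((u x ^ 2 + x * (2 * u x * u' x)) + ((1 / 2) * u x ^ 2 + 2 * u' x ^ 2)) := by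
    refine intervalIntegral.integral_mono_on zero_le_one hi
      (hD.add ((hi.const_mul _).add (hi'.const_mul _))) fun x hx => ?_
    have hx2 : x ^ 2 ≤ 1 := by nlinarith [hx.1, hx.2]
    nlinarith [sq_nonneg (u x + 2 * (x * u' x)),
      mul_nonneg (sub_nonneg.2 hx2) (sq_nonneg (u' x))]
  rw [intervalIntegral.integral_add hD ((hi.const_mul _).add (hi'.const_mul _)),
    intervalIntegral.integral_add (hi.const_mul _) (hi'.const_mul _),
    intervalIntegral.integral_const_mul, intervalIntegral.integral_const_mul, hftc] at hmono
  linarith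

theorem boundary_add_integral_sq_le {u u' : ℝ → ℝ}
    (hu : ∀ x ∈ Icc (0 : ℝ) 1, HasDerivWithinAt u (u' x) (Icc 0 1) x)
    (hu' : ContinuousOn u' (Icc 0 1)) {a c p : ℝ} (hc : 0 ≤ c) (hca : 5 * c ≤ a)
    (hp : 5 * c / 2 + a / 2 ≤ p) :
    c * u 0 ^ 2 + (a / 4 - 5 * c / 4) * (∫ x in (0 : ℝ)..1, u x ^ 2)
      ≤ p * u 1 ^ 2 + a * ∫ x in (0 : ℝ)..1, u' x ^ 2 := by
  have hpoinc := integral_sq_le_of_hasDerivWithinAt hu hu'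
  have hzero := sq_zero_le_of_hasDerivWithinAt hu hu'
  have hnonneg : 0 ≤ ∫ x in (0 : ℝ)..1, u' x ^ 2 :=
    intervalIntegral.integral_nonneg zero_le_one fun x _ => sq_nonneg _
  nlinarith [mul_le_mul_of_nonneg_left hzero hc,
    mul_le_mul_of_nonneg_left hpoinc (sub_nonneg.2 hca),
    mul_le_mul_of_nonneg_right hp (sq_nonneg (u 1)), mul_nonneg hc hnonneg,
    mul_nonneg hc (sq_nonneg (u 1))]

theorem mul_le_half_mul_sq_add {k : ℝ} (hk : 0 < k) (x y : ℝ) :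
    x * y ≤ k / 2 * x ^ 2 + 1 / (2 * k) * y ^ 2 := by
  have h : k / 2 * x ^ 2 + 1 / (2 * k) * y ^ 2 - x * y = (k * x - y) ^ 2 / (2 * k) := by
    field_simp
    ring
  have : 0 ≤ (k * x - y) ^ 2 / (2 * k) := by positivity
  linarith

theorem etc_lyapunov_core_inequality (ε lam q r : ℝ)
    (hε : 0 < ε) (hlam : 0 < lam) (hq : (lam + ε) / (2 * ε) < q)
    (hr : r = q - lam / (2 * ε))
    (g : ℝ → ℝ) (hg : ContinuousOn g (Icc 0 1))
    (η β₁ β₂ β₃ κ₁ κ₂ κ₃ B A ρ : ℝ)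
    (hη : 0 < η) (hβ₁ : 0 < β₁) (hβ₂ : 0 < β₂) (hβ₃ : 0 < β₃)
    (hκ₁ : 0 < κ₁) (hκ₂ : 0 < κ₂) (hκ₃ : 0 < κ₃) (hB : 0 < B) (hA : 0 < A)
    (hBcond : 0 < B * (ε * min (r - 1/2) (1/2) - ε / (2 * κ₁) - 5 * lam / (8 * κ₂)
        - (∫ x in (0:ℝ)..1, (g x) ^ 2) / κ₃) - 2 * β₁ - β₂)
    (hAcond : 0 < A * ε * min (q - 1/2) (1/2) - 5 * lam * κ₂ * B / 8
        - 5 * κ₃ * B / 4 - 5 * β₃ / 2)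
    (hρ : ρ = ε * κ₁ * B / 2)
    (b₁ b₂ ϱ : ℝ)
    (hb₁ : b₁ = A * ε / 4 - 5 * lam * κ₂ * B / 16 - 5 * κ₃ * B / 8 - 5 * β₃ / 4)
    (hb₂ : b₂ = ε * B / 4 - 5 * lam * B / (16 * κ₂)
        - (∫ x in (0:ℝ)..1, (g x) ^ 2) * B / (2 * κ₃) - β₁)
    (hϱ : ϱ = min b₁ (min b₂ η) / max (A / 2) (max (B / 2) 1)) :
    ∀ (v v' w w' : ℝ → ℝ),
      (∀ x ∈ Icc (0:ℝ) 1, HasDerivWithinAt v (v' x) (Icc 0 1) x) →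
      ContinuousOn v' (Icc 0 1) →
      (∀ x ∈ Icc (0:ℝ) 1, HasDerivWithinAt w (w' x) (Icc 0 1) x) →
      ContinuousOn w' (Icc 0 1) →
      ∀ (d m : ℝ), m ≤ 0 →
        -A * ε * q * (v 1) ^ 2 - A * ε * (∫ x in (0:ℝ)..1, (v' x) ^ 2)
          - r * ε * B * (w 1) ^ 2 + ε * B * d * w 1
          + lam * B / 2 * w 0 * v 0
          - ε * B * (∫ x in (0:ℝ)..1, (w' x) ^ 2)
          + B * v 0 * (∫ x in (0:ℝ)..1, g x * w x)
          + η * m - ρ * d ^ 2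
          + β₁ * (∫ x in (0:ℝ)..1, (w x) ^ 2) + β₂ * (w 1) ^ 2 + β₃ * (v 0) ^ 2
        ≤ -ϱ * (A / 2 * (∫ x in (0:ℝ)..1, (v x) ^ 2)
            + B / 2 * (∫ x in (0:ℝ)..1, (w x) ^ 2) - m) := by
  intro v v' w w' hv hv' hw hw' d m hm
  have hwc : ContinuousOn w (Icc 0 1) := fun x hx => (hw x hx).continuousWithinAt
  have hG : 0 ≤ ∫ x in (0 : ℝ)..1, g x ^ 2 :=
    intervalIntegral.integral_nonneg zero_le_one fun x _ => sq_nonneg _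
  have hV : 0 ≤ ∫ x in (0 : ℝ)..1, v x ^ 2 :=
    intervalIntegral.integral_nonneg zero_le_one fun x _ => sq_nonneg _
  have hW : 0 ≤ ∫ x in (0 : ℝ)..1, w x ^ 2 :=
    intervalIntegral.integral_nonneg zero_le_one fun x _ => sq_nonneg _
  have hcs := sq_intervalIntegral_mul_le zero_le_one hg hwc
  set c := lam * κ₂ * B / 4 + κ₃ * B / 2 + β₃ with hc_def
  set e := lam * B / (4 * κ₂) with he_def
  have hc : 0 < c := by positivity
  have he : 0 < e := by positivity
  have hGB : 0 ≤ (∫ x in (0 : ℝ)..1, g x ^ 2) * B / (2 * κ₃) := by positivity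
  have hκB : 0 < ε * B / (2 * κ₁) := by positivity
  have hA₁ : A * ε * min (q - 1/2) (1/2) ≤ A * ε * (q - 1/2) :=
    mul_le_mul_of_nonneg_left (min_le_left _ _) (by positivity)
  have hA₂ : A * ε * min (q - 1/2) (1/2) ≤ A * ε * (1/2) :=
    mul_le_mul_of_nonneg_left (min_le_right _ _) (by positivity)
  have hB₁ : ε * B * min (r - 1/2) (1/2) ≤ ε * B * (r - 1/2) :=
    mul_le_mul_of_nonneg_left (min_le_left _ _) (by positivity)
  have hB₂ : ε * B * min (r - 1/2) (1/2) ≤ ε * B * (1/2) :=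
    mul_le_mul_of_nonneg_left (min_le_right _ _) (by positivity)
  have hBcond' : 0 < ε * B * min (r - 1/2) (1/2) - ε * B / (2 * κ₁) - 5 * e / 2
      - 2 * ((∫ x in (0 : ℝ)..1, g x ^ 2) * B / (2 * κ₃)) - 2 * β₁ - β₂ := by
    convert hBcond using 1
    rw [he_def]
    field_simp
    ring
  have hb₁' : b₁ = A * ε / 4 - 5 * c / 4 := by rw [hb₁, hc_def]; ring
  have hb₂' : b₂ = ε * B / 4 - 5 * e / 4
      - (∫ x in (0 : ℝ)..1, g x ^ 2) * B / (2 * κ₃) - β₁ := by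
    rw [hb₂, he_def]
    field_simp
    ring
  have hv_est := boundary_add_integral_sq_le hv hv' (a := A * ε) (p := A * ε * q) hc.le
    (by linarith) (by linarith)
  have hw_est := boundary_add_integral_sq_le hw hw' (a := ε * B)
    (p := r * ε * B - ε * B / (2 * κ₁) - β₂) he.le (by linarith) (by linarith)
  have hmin : 0 < min b₁ (min b₂ η) :=
    lt_min (by linarith) (lt_min (by linarith) hη)
  have hmax : 0 < max (A / 2) (max (B / 2) 1) := lt_max_of_lt_left (by positivity)
  have hrate : ∀ s ≤ max (A / 2) (max (B / 2) 1), ϱ * s ≤ min b₁ (min b₂ η) := by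
    intro s hs
    rw [hϱ, div_mul_eq_mul_div, div_le_iff₀ hmax]
    exact mul_le_mul_of_nonneg_left hs hmin.le
  have hϱA : ϱ * (A / 2) ≤ b₁ := (hrate _ (le_max_left _ _)).trans (min_le_left _ _)
  have hϱB : ϱ * (B / 2) ≤ b₂ :=
    (hrate _ ((le_max_left _ _).trans (le_max_right _ _))).trans
      ((min_le_right _ _).trans (min_le_left _ _))
  have hϱη : ϱ * 1 ≤ η :=
    (hrate _ ((le_max_right _ _).trans (le_max_right _ _))).trans
      ((min_le_right _ _).trans (min_le_right _ _))
  have hyoung₁ : ε * B * d * w 1 ≤ ρ * d ^ 2 + ε * B / (2 * κ₁) * w 1 ^ 2 := by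
    have h := mul_le_mul_of_nonneg_left (mul_le_half_mul_sq_add hκ₁ d (w 1)) (mul_pos hε hB).le
    rw [hρ]
    calc _ = ε * B * (d * w 1) := by ring
      _ ≤ _ := h
      _ = _ := by ring
  have hyoung₂ : lam * B / 2 * w 0 * v 0 ≤ lam * κ₂ * B / 4 * v 0 ^ 2 + e * w 0 ^ 2 := by
    have h := mul_le_mul_of_nonneg_left (mul_le_half_mul_sq_add hκ₂ (v 0) (w 0))
      (show 0 ≤ lam * B / 2 by positivity)
    calc _ = lam * B / 2 * (v 0 * w 0) := by ring
      _ ≤ _ := h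
      _ = _ := by rw [he_def]; field_simp; ring
  have hyoung₃ : B * v 0 * (∫ x in (0 : ℝ)..1, g x * w x) ≤ κ₃ * B / 2 * v 0 ^ 2
      + (∫ x in (0 : ℝ)..1, g x ^ 2) * B / (2 * κ₃) * ∫ x in (0 : ℝ)..1, w x ^ 2 := by
    have h := mul_le_mul_of_nonneg_left
      (mul_le_half_mul_sq_add hκ₃ (v 0) (∫ x in (0 : ℝ)..1, g x * w x)) hB.le
    have h' := mul_le_mul_of_nonneg_left hcs (show 0 ≤ B / (2 * κ₃) by positivity)
    calc _ = B * (v 0 * ∫ x in (0 : ℝ)..1, g x * w x) := by ring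
      _ ≤ _ := h
      _ = κ₃ * B / 2 * v 0 ^ 2 + B / (2 * κ₃) * (∫ x in (0 : ℝ)..1, g x * w x) ^ 2 := by ring
      _ ≤ _ := add_le_add_right h' _
      _ = _ := by ring
  have hVrate := mul_le_mul_of_nonneg_right hϱA hV
  have hWrate := mul_le_mul_of_nonneg_right hϱB hW
  have hmrate := mul_le_mul_of_nonneg_right hϱη (neg_nonneg.2 hm)
  rw [hb₁'] at hVrate
  rw [hb₂'] at hWrate
  have hcv : c * v 0 ^ 2 = lam * κ₂ * B / 4 * v 0 ^ 2 + κ₃ * B / 2 * v 0 ^ 2 + β₃ * v 0 ^ 2 := by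
    rw [hc_def]; ring
  linarith
end

section
/- Let ε, λ > 0 and q > (λ+ε)/(2ε), and set r = q − λ/(2ε). Let g : [0,1] → ℝ be continuous with ‖g‖² = ∫₀¹ g(x)² dx. Let δ₁, δ₂ > 0 satisfy ε·min{r − 1/2, 1/2} − 5λ/(8δ₁) − ‖g‖²/δ₂ ≥ 0, and let H > 0 satisfy H·ε·min{q − 1/2, 1/2} − (5λδ₁)/8 − (5δ₂)/4 ≥ 0. Define ϑ₁ = Hε/4 − 5λδ₁/16 − 5δ₂/8 and ϑ₂ = ε/4 − 5λ/(16δ₁) − ‖g‖²/(2δ₂). Then for all continuously differentiable v, w : [0,1] → ℝ: −Hεq·v(1)² − Hε·∫₀¹ v′(x)² dx − rε·w(1)² + (λ/2)·w(0)·v(0) − ε·∫₀¹ w′(x)² dx + v(0)·∫₀¹ g(x)·w(x) dx ≤ −ϑ₁·∫₀¹ v(x)² dx − ϑ₂·∫₀¹ w(x)² dx. -/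
open Real Set

theorem sq_apply_zero_le {v v' : ℝ → ℝ}
    (hv : ∀ x ∈ Icc (0 : ℝ) 1, HasDerivWithinAt v (v' x) (Icc 0 1) x)
    (hv' : ContinuousOn v' (Icc 0 1)) :
    v 0 ^ 2 ≤ 2 * v 1 ^ 2 + 2 * ∫ x in (0 : ℝ)..1, v' x ^ 2 := by
  have hftc : ∫ x in (0 : ℝ)..1, v' x = v 1 - v 0 :=
    intervalIntegral.integral_eq_sub_of_hasDerivAt_of_le zero_le_one
      (fun x hx => (hv x hx).continuousWithinAt)
      (fun x hx => (hv x (Ioo_subset_Icc_self hx)).hasDerivAt (Icc_mem_nhds hx.1 hx.2))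
      (hv'.intervalIntegrable_of_Icc zero_le_one)
  have hcs := sq_intervalIntegral_mul_le (f := fun _ => 1) zero_le_one continuousOn_const hv'
  simp only [one_mul, one_pow, intervalIntegral.integral_const, sub_zero, smul_eq_mul,
    hftc] at hcs
  nlinarith [sq_nonneg (2 * v 1 - v 0)]

theorem poincare_integral_sq_le {v v' : ℝ → ℝ}
    (hv : ∀ x ∈ Icc (0 : ℝ) 1, HasDerivWithinAt v (v' x) (Icc 0 1) x)
    (hv' : ContinuousOn v' (Icc 0 1)) :
    ∫ x in (0 : ℝ)..1, v x ^ 2 ≤ 2 * v 1 ^ 2 + 4 * ∫ x in (0 : ℝ)..1, v' x ^ 2 := by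
  have hvc : ContinuousOn v (Icc 0 1) := fun x hx => (hv x hx).continuousWithinAt
  have hint : IntervalIntegrable (fun x => v x ^ 2 + x * (2 * v x * v' x))
      MeasureTheory.volume 0 1 :=
    ContinuousOn.intervalIntegrable_of_Icc zero_le_one (by fun_prop)
  have hvv : IntervalIntegrable (fun x => v x ^ 2) MeasureTheory.volume 0 1 :=
    ContinuousOn.intervalIntegrable_of_Icc zero_le_one (by fun_prop)
  have hvv' : IntervalIntegrable (fun x => v' x ^ 2) MeasureTheory.volume 0 1 :=
    ContinuousOn.intervalIntegrable_of_Icc zero_le_one (by fun_prop)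
  have hftc : ∫ x in (0 : ℝ)..1, (v x ^ 2 + x * (2 * v x * v' x)) = 1 * v 1 ^ 2 - 0 * v 0 ^ 2 :=
    intervalIntegral.integral_eq_sub_of_hasDerivAt_of_le (f := fun x => x * v x ^ 2) zero_le_one
      (by fun_prop)
      (fun x hx => by
        have h := (hv x (Ioo_subset_Icc_self hx)).hasDerivAt (Icc_mem_nhds hx.1 hx.2)
        exact ((hasDerivAt_id' x).mul (h.pow 2)).congr_deriv (by simp))
      hint
  have hmono : ∫ x in (0 : ℝ)..1, (1 / 2 * v x ^ 2 - 2 * v' x ^ 2)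
      ≤ ∫ x in (0 : ℝ)..1, (v x ^ 2 + x * (2 * v x * v' x)) :=
    intervalIntegral.integral_mono_on zero_le_one
      ((hvv.const_mul _).sub (hvv'.const_mul _)) hint fun x hx => by
        have hx2 : x ^ 2 ≤ 1 := pow_le_one₀ hx.1 hx.2
        nlinarith [sq_nonneg (v x + 2 * x * v' x),
          mul_nonneg (sub_nonneg.2 hx2) (sq_nonneg (v' x))]
  rw [hftc, intervalIntegral.integral_sub (hvv.const_mul _) (hvv'.const_mul _),
    intervalIntegral.integral_const_mul, intervalIntegral.integral_const_mul] at hmono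
  linarith

theorem boundary_dissipation_le {v v' : ℝ → ℝ}
    (hv : ∀ x ∈ Icc (0 : ℝ) 1, HasDerivWithinAt v (v' x) (Icc 0 1) x)
    (hv' : ContinuousOn v' (Icc 0 1)) {E p c : ℝ} (hE : 0 ≤ E) (hc : 0 ≤ c)
    (hcond : 5 / 2 * c ≤ E * min (p - 1 / 2) (1 / 2)) :
    c * v 0 ^ 2 + (E / 4 - 5 / 4 * c) * (∫ x in (0 : ℝ)..1, v x ^ 2)
      ≤ E * p * v 1 ^ 2 + E * ∫ x in (0 : ℝ)..1, v' x ^ 2 := by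
  have hP := poincare_integral_sq_le hv hv'
  have hQ := sq_apply_zero_le hv hv'
  have hD : 0 ≤ ∫ x in (0 : ℝ)..1, v' x ^ 2 :=
    intervalIntegral.integral_nonneg zero_le_one fun x _ => sq_nonneg _
  set D := ∫ x in (0 : ℝ)..1, v' x ^ 2
  set V := ∫ x in (0 : ℝ)..1, v x ^ 2
  set m := min (p - 1 / 2) (1 / 2)
  have hmp : m ≤ p - 1 / 2 := min_le_left _ _
  have hm : m ≤ 1 / 2 := min_le_right _ _
  have hb : 0 ≤ v 1 ^ 2 := sq_nonneg _
  have h1 : 0 ≤ E * (p - 1 / 2 - m) * v 1 ^ 2 :=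
    mul_nonneg (mul_nonneg hE (sub_nonneg.2 hmp)) hb
  have h2 : 0 ≤ E * (1 - 2 * m) * (v 1 ^ 2 / 2 + D - V / 4) :=
    mul_nonneg (mul_nonneg hE (by linarith)) (by linarith)
  have h3 : 0 ≤ (2 * (E * m) - 5 * c) * (v 1 ^ 2 + D - V / 4) :=
    mul_nonneg (by linarith) (by linarith)
  have h4 : 0 ≤ c * (5 * v 1 ^ 2 + 5 * D - v 0 ^ 2) := mul_nonneg hc (by linarith)
  linarith

theorem mul_le_weighted_sq {δ : ℝ} (hδ : 0 < δ) {a b B : ℝ} (hb : b ^ 2 ≤ B) :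
    a * b ≤ δ / 2 * a ^ 2 + B / (2 * δ) := by
  have h : δ / 2 * a ^ 2 + B / (2 * δ) - a * b
      = ((δ * a - b) ^ 2 + (B - b ^ 2)) / (2 * δ) := by
    field_simp
    ring
  have : 0 ≤ ((δ * a - b) ^ 2 + (B - b ^ 2)) / (2 * δ) :=
    div_nonneg (add_nonneg (sq_nonneg _) (sub_nonneg.2 hb)) (by positivity)
  linarith

theorem ctc_lyapunov_core_inequality (ε lam q r : ℝ)
    (hε : 0 < ε) (hlam : 0 < lam) (hq : (lam + ε) / (2 * ε) < q)
    (hr : r = q - lam / (2 * ε))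
    (g : ℝ → ℝ) (hg : ContinuousOn g (Icc 0 1))
    (δ₁ δ₂ H : ℝ) (hδ₁ : 0 < δ₁) (hδ₂ : 0 < δ₂) (hH : 0 < H)
    (hδcond : 0 ≤ ε * min (r - 1/2) (1/2) - 5 * lam / (8 * δ₁)
        - (∫ x in (0:ℝ)..1, (g x) ^ 2) / δ₂)
    (hHcond : 0 ≤ H * ε * min (q - 1/2) (1/2) - 5 * lam * δ₁ / 8 - 5 * δ₂ / 4)
    (ϑ₁ ϑ₂ : ℝ)
    (hϑ₁ : ϑ₁ = H * ε / 4 - 5 * lam * δ₁ / 16 - 5 * δ₂ / 8)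
    (hϑ₂ : ϑ₂ = ε / 4 - 5 * lam / (16 * δ₁) - (∫ x in (0:ℝ)..1, (g x) ^ 2) / (2 * δ₂)) :
    ∀ (v v' w w' : ℝ → ℝ),
      (∀ x ∈ Icc (0:ℝ) 1, HasDerivWithinAt v (v' x) (Icc 0 1) x) →
      ContinuousOn v' (Icc 0 1) →
      (∀ x ∈ Icc (0:ℝ) 1, HasDerivWithinAt w (w' x) (Icc 0 1) x) →
      ContinuousOn w' (Icc 0 1) →
        -H * ε * q * (v 1) ^ 2 - H * ε * (∫ x in (0:ℝ)..1, (v' x) ^ 2)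
          - r * ε * (w 1) ^ 2 + lam / 2 * w 0 * v 0
          - ε * (∫ x in (0:ℝ)..1, (w' x) ^ 2)
          + v 0 * (∫ x in (0:ℝ)..1, g x * w x)
        ≤ -ϑ₁ * (∫ x in (0:ℝ)..1, (v x) ^ 2) - ϑ₂ * ∫ x in (0:ℝ)..1, (w x) ^ 2 := by
  intro v v' w w' hv hv' hw hw'
  have hwc : ContinuousOn w (Icc 0 1) := fun x hx => (hw x hx).continuousWithinAt
  have hG : 0 ≤ ∫ x in (0 : ℝ)..1, g x ^ 2 :=
    intervalIntegral.integral_nonneg zero_le_one fun x _ => sq_nonneg _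
  have hY₁ := mul_le_weighted_sq hδ₁ (a := v 0) (le_refl (w 0 ^ 2))
  have hY₂ := mul_le_weighted_sq hδ₂ (a := v 0) (sq_intervalIntegral_mul_le zero_le_one hg hwc)
  have hGδ := div_nonneg hG hδ₂.le
  have e₁ : 5 * lam / (8 * δ₁) = 5 / 2 * (lam / (4 * δ₁)) := by field_simp; ring
  have e₂ : 5 * lam / (16 * δ₁) = 5 / 4 * (lam / (4 * δ₁)) := by field_simp; ring
  have hV := boundary_dissipation_le hv hv' (E := H * ε) (p := q)
    (c := lam * δ₁ / 4 + δ₂ / 2) (by positivity) (by positivity) (by linarith)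
  have hW := boundary_dissipation_le hw hw' hε.le (p := r) (c := lam / (4 * δ₁))
    (by positivity) (by linarith)
  have hY₁' := mul_le_mul_of_nonneg_left hY₁ (by positivity : 0 ≤ lam / 2)
  have e₃ : lam / 2 * (δ₁ / 2 * v 0 ^ 2 + w 0 ^ 2 / (2 * δ₁))
      = lam * δ₁ / 4 * v 0 ^ 2 + lam / (4 * δ₁) * w 0 ^ 2 := by field_simp; ring
  rw [e₃] at hY₁'
  rw [mul_div_right_comm] at hY₂
  rw [hϑ₁, hϑ₂, e₂]
  linarith
end
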